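/- arXiv:math/0311336 — 11 statements merged into one kernel-verified Lean document; each statement's English description precedes it below -/
import Mathlib

section
/- Let (X, μ) and (Y, ν) be measure spaces, let 1 ≤ p < ∞ with p ≠ 2, and let T : L^p(μ; ℂ) → L^p(ν; ℂ) be a linear isometry (not assumed surjective). If f, g ∈ L^p(μ; ℂ) satisfy f·g = 0 μ-almost everywhere, then T(f)·T(g) = 0 ν-almost everywhere. -/
open MeasureTheory ENNReal

noncomputable def clD (q : ℝ) (a b : ℂ) : ℝ :=
  ‖a + b‖ ^ q + ‖a - b‖ ^ q - 2 * ‖a‖ ^ q - 2 * ‖b‖ ^ q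

lemma clD_zero {q : ℝ} (hq : 0 < q) {a b : ℂ} (h : a * b = 0) : clD q a b = 0 := by
  have h0 : (0:ℝ) ^ q = 0 := Real.zero_rpow hq.ne'
  rcases mul_eq_zero.1 h with h | h <;> subst h <;> simp [clD, h0] <;> ring

lemma rpow_sq_half (x q : ℝ) (hx : 0 ≤ x) : x ^ q = (x ^ 2) ^ (q / 2) := by
  rw [← Real.rpow_natCast x 2, ← Real.rpow_mul hx]; congr 1; push_cast; ring

lemma rpow_split {A r : ℝ} (hA : 0 < A) : A ^ r = A * A ^ (r - 1) := by
  rw [Real.rpow_sub_one hA.ne']; field_simp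

lemma par (a b : ℂ) : (1/2 : ℝ) * ‖a + b‖ ^ 2 + (1/2) * ‖a - b‖ ^ 2 = ‖a‖ ^ 2 + ‖b‖ ^ 2 := by
  have := parallelogram_law_with_norm ℝ a b
  nlinarith

lemma clD_pos {q : ℝ} (hq : 2 < q) {a b : ℂ} (h : a * b ≠ 0) : 0 < clD q a b := by
  obtain ⟨ha, hb⟩ := mul_ne_zero_iff.1 h
  have hA : 0 < ‖a‖ ^ 2 := by positivity
  have hB : 0 < ‖b‖ ^ 2 := by positivity
  have hc := (convexOn_rpow (p := q / 2) (by linarith)).2 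
    (Set.mem_Ici.2 (sq_nonneg ‖a + b‖)) (Set.mem_Ici.2 (sq_nonneg ‖a - b‖))
    (show (0:ℝ) ≤ 1/2 by norm_num) (show (0:ℝ) ≤ 1/2 by norm_num) (by norm_num)
  simp only [smul_eq_mul] at hc
  rw [par] at hc
  unfold clD
  rw [rpow_sq_half _ q (norm_nonneg (a+b)), rpow_sq_half _ q (norm_nonneg (a-b)),
    rpow_sq_half _ q (norm_nonneg a), rpow_sq_half _ q (norm_nonneg b)]
  generalize ‖a‖ ^ 2 = A at *
  generalize ‖b‖ ^ 2 = B at *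
  rw [rpow_split (add_pos hA hB)] at hc
  rw [rpow_split hA, rpow_split hB]
  have h1 : A ^ (q/2-1) < (A+B) ^ (q/2-1) :=
    Real.rpow_lt_rpow hA.le (by linarith) (by linarith)
  have h2 : B ^ (q/2-1) < (A+B) ^ (q/2-1) :=
    Real.rpow_lt_rpow hB.le (by linarith) (by linarith)
  have h3 := mul_lt_mul_of_pos_left h1 hA
  have h4 := mul_lt_mul_of_pos_left h2 hB
  linarith

lemma clD_neg {q : ℝ} (hq0 : 0 < q) (hq : q < 2) {a b : ℂ} (h : a * b ≠ 0) : clD q a b < 0 := by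
  obtain ⟨ha, hb⟩ := mul_ne_zero_iff.1 h
  have hA : 0 < ‖a‖ ^ 2 := by positivity
  have hB : 0 < ‖b‖ ^ 2 := by positivity
  have hc := (Real.concaveOn_rpow (p := q / 2) (by linarith) (by linarith)).2
    
    (Set.mem_Ici.2 (sq_nonneg ‖a + b‖)) (Set.mem_Ici.2 (sq_nonneg ‖a - b‖))
    (show (0:ℝ) ≤ 1/2 by norm_num) (show (0:ℝ) ≤ 1/2 by norm_num) (by norm_num)
  simp only [smul_eq_mul] at hc
  rw [par] at hc
  unfold clD
  rw [rpow_sq_half _ q (norm_nonneg (a+b)), rpow_sq_half _ q (norm_nonneg (a-b)),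
    rpow_sq_half _ q (norm_nonneg a), rpow_sq_half _ q (norm_nonneg b)]
  generalize ‖a‖ ^ 2 = A at *
  generalize ‖b‖ ^ 2 = B at *
  rw [rpow_split (add_pos hA hB)] at hc
  rw [rpow_split hA, rpow_split hB]
  have h1 : (A+B) ^ (q/2-1) < A ^ (q/2-1) :=
    Real.rpow_lt_rpow_of_neg hA (by linarith) (by linarith)
  have h2 : (A+B) ^ (q/2-1) < B ^ (q/2-1) :=
    Real.rpow_lt_rpow_of_neg hB (by linarith) (by linarith)
  have h3 := mul_lt_mul_of_pos_left h1 hA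
  have h4 := mul_lt_mul_of_pos_left h2 hB
  linarith

lemma int_pow {X : Type*} [MeasurableSpace X] {μ : Measure X} {p : ℝ≥0∞}
    (h0 : p ≠ 0) (ht : p ≠ ∞) (f : Lp ℂ p μ) :
    Integrable (fun x => ‖f x‖ ^ p.toReal) μ ∧ ∫ x, ‖f x‖ ^ p.toReal ∂μ = ‖f‖ ^ p.toReal := by
  refine ⟨(Lp.memLp f).integrable_norm_rpow h0 ht, ?_⟩
  have hn : 0 ≤ ∫ x, ‖f x‖ ^ p.toReal ∂μ := integral_nonneg fun x => by positivity
  rw [Lp.norm_def, (Lp.memLp f).eLpNorm_eq_integral_rpow_norm h0 ht,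
    ENNReal.toReal_ofReal (by positivity), Real.rpow_inv_rpow hn (ENNReal.toReal_pos h0 ht).ne']

lemma int_clD {X : Type*} [MeasurableSpace X] {μ : Measure X} {p : ℝ≥0∞}
    (h0 : p ≠ 0) (ht : p ≠ ∞) (f g : Lp ℂ p μ) :
    Integrable (fun x => clD p.toReal (f x) (g x)) μ ∧
    ∫ x, clD p.toReal (f x) (g x) ∂μ = ‖f + g‖ ^ p.toReal + ‖f - g‖ ^ p.toReal
      - 2 * ‖f‖ ^ p.toReal - 2 * ‖g‖ ^ p.toReal := by
  obtain ⟨i1, e1⟩ := int_pow h0 ht (f + g)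
  obtain ⟨i2, e2⟩ := int_pow h0 ht (f - g)
  obtain ⟨i3, e3⟩ := int_pow h0 ht f
  obtain ⟨i4, e4⟩ := int_pow h0 ht g
  have hae : (fun x => ‖(f + g) x‖ ^ p.toReal + ‖(f - g) x‖ ^ p.toReal
      - 2 * ‖f x‖ ^ p.toReal - 2 * ‖g x‖ ^ p.toReal) =ᵐ[μ]
      fun x => clD p.toReal (f x) (g x) := by
    filter_upwards [Lp.coeFn_add f g, Lp.coeFn_sub f g] with x h1 h2
    rw [h1, h2]; rfl
  have i12 : Integrable (fun x => ‖(f + g) x‖ ^ p.toReal + ‖(f - g) x‖ ^ p.toReal) μ := i1.add i2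
  have i123 : Integrable (fun x => ‖(f + g) x‖ ^ p.toReal + ‖(f - g) x‖ ^ p.toReal
      - 2 * ‖f x‖ ^ p.toReal) μ := i12.sub (i3.const_mul 2)
  have i3' := i3.const_mul 2
  have i4' := i4.const_mul 2
  refine ⟨(i123.sub i4').congr hae, ?_⟩
  rw [← integral_congr_ae hae, ← e1, ← e2, ← e3, ← e4, ← integral_const_mul, ← integral_const_mul,
    ← integral_add i1 i2, ← integral_sub i12 i3', ← integral_sub i123 i4']

/-- A linear isometry between complex `L^p` spaces (`1 ≤ p < ∞`, `p ≠ 2`)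
preserves disjointness of supports. -/
theorem stmt1 {X Y : Type*} [MeasurableSpace X] [MeasurableSpace Y]
    (μ : Measure X) (ν : Measure Y) (p : ℝ≥0∞)
    (hp1 : 1 ≤ p) (hptop : p ≠ ∞) (hp2 : p ≠ 2)
    (T : Lp ℂ p μ →ₗ[ℂ] Lp ℂ p ν) (hT : ∀ f, ‖T f‖ = ‖f‖)
    (f g : Lp ℂ p μ) (hfg : ∀ᵐ x ∂μ, f x * g x = 0) :
    ∀ᵐ y ∂ν, (T f) y * (T g) y = 0 := by
  have h0 : p ≠ 0 := (lt_of_lt_of_le one_pos hp1).ne'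
  have hq0 : 0 < p.toReal := ENNReal.toReal_pos h0 hptop
  have hq2 : p.toReal ≠ 2 := by
    intro h
    apply hp2
    rw [← ENNReal.ofReal_toReal hptop, h]; simp
  obtain ⟨-, e⟩ := int_clD h0 hptop f g
  obtain ⟨i, e'⟩ := int_clD h0 hptop (T f) (T g)
  rw [← map_add, ← map_sub, hT, hT, hT, hT, ← e] at e'
  have hz : ∫ x, clD p.toReal (f x) (g x) ∂μ = 0 := by
    apply integral_eq_zero_of_ae
    filter_upwards [hfg] with x hx using clD_zero hq0 hx
  rw [hz] at e'
  rcases lt_or_gt_of_ne hq2 with h | h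
  · have hnn : 0 ≤ fun y => -clD p.toReal (T f y) (T g y) := by
      intro y
      by_cases hy : T f y * T g y = 0
      · simp [clD_zero hq0 hy]
      · have := clD_neg hq0 h hy
        simp only [Pi.zero_apply]; linarith
    have := (integral_eq_zero_iff_of_nonneg hnn i.neg).1 (by rw [integral_neg, e', neg_zero])
    filter_upwards [this] with y hy
    by_contra hc
    have := clD_neg hq0 h hc
    simp only [Pi.zero_apply] at hy; linarith
  · have hnn : 0 ≤ fun y => clD p.toReal (T f y) (T g y) := by
      intro y
      by_cases hy : T f y * T g y = 0
      · simp [clD_zero hq0 hy]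
      · exact (clD_pos h hy).le
    have := (integral_eq_zero_iff_of_nonneg hnn i).1 e'
    filter_upwards [this] with y hy
    by_contra hc
    have := clD_pos h hc
    simp only [Pi.zero_apply] at hy; linarith
end

section
/- Let (X, μ) be a measure space, let 1 ≤ p < ∞ with p ≠ 2, and let f, g ∈ L^p(μ; ℂ). Then ‖f + g‖_p^p + ‖f − g‖_p^p = 2(‖f‖_p^p + ‖g‖_p^p) if and only if f·g = 0 μ-almost everywhere. -/
open MeasureTheory ENNReal

lemma aux_sup {q s t : ℝ} (hq : 1 < q) (hs : 0 < s) (ht : 0 < t) :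
    s ^ q + t ^ q < (s + t) ^ q := by
  have e : ∀ x : ℝ, 0 < x → x ^ q = x * x ^ (q - 1) := by
    intro x hx
    rw [← Real.rpow_one_add' hx.le (by linarith)]; congr 1; ring
  rw [e s hs, e t ht, e _ (add_pos hs ht)]
  have h1 : s ^ (q - 1) < (s + t) ^ (q - 1) :=
    Real.rpow_lt_rpow hs.le (by linarith) (by linarith)
  have h2 : t ^ (q - 1) < (s + t) ^ (q - 1) :=
    Real.rpow_lt_rpow ht.le (by linarith) (by linarith)
  nlinarith [mul_lt_mul_of_pos_left h1 hs, mul_lt_mul_of_pos_left h2 ht]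

lemma aux_sub {q s t : ℝ} (hq0 : 0 < q) (hq : q < 1) (hs : 0 < s) (ht : 0 < t) :
    (s + t) ^ q < s ^ q + t ^ q := by
  have e : ∀ x : ℝ, 0 < x → x ^ q = x * x ^ (q - 1) := by
    intro x hx
    rw [← Real.rpow_one_add' hx.le (by linarith)]; congr 1; ring
  rw [e s hs, e t ht, e _ (add_pos hs ht)]
  have h1 : (s + t) ^ (q - 1) < s ^ (q - 1) :=
    Real.rpow_lt_rpow_of_neg hs (by linarith) (by linarith)
  have h2 : (s + t) ^ (q - 1) < t ^ (q - 1) :=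
    Real.rpow_lt_rpow_of_neg ht (by linarith) (by linarith)
  nlinarith [mul_lt_mul_of_pos_left h1 hs, mul_lt_mul_of_pos_left h2 ht]

lemma aux_pow (r : ℝ) (a : ℂ) : ‖a‖ ^ r = (‖a‖ ^ 2) ^ (r / 2) := by
  rw [← Real.rpow_natCast, ← Real.rpow_mul (norm_nonneg _)]; congr 1; push_cast; ring

lemma aux_par (a b : ℂ) :
    (1 / 2 : ℝ) * ‖a + b‖ ^ 2 + (1 / 2) * ‖a - b‖ ^ 2 = ‖a‖ ^ 2 + ‖b‖ ^ 2 := by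
  have := parallelogram_law_with_norm ℝ a b
  nlinarith

lemma aux_zero {r : ℝ} (hr : 0 < r) {a b : ℂ} (h : a * b = 0) :
    ‖a + b‖ ^ r + ‖a - b‖ ^ r - 2 * (‖a‖ ^ r + ‖b‖ ^ r) = 0 := by
  rcases mul_eq_zero.1 h with h | h <;> subst h <;> simp [Real.zero_rpow hr.ne'] <;> ring

lemma aux_gt {r : ℝ} (hr : 2 < r) {a b : ℂ} (h : a * b ≠ 0) :
    0 < ‖a + b‖ ^ r + ‖a - b‖ ^ r - 2 * (‖a‖ ^ r + ‖b‖ ^ r) := by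
  obtain ⟨ha, hb⟩ := mul_ne_zero_iff.1 h
  have h1 := aux_sup (q := r / 2) (by linarith) (pow_pos (norm_pos_iff.2 ha) 2)
    (pow_pos (norm_pos_iff.2 hb) 2)
  have h2 := (convexOn_rpow (p := r / 2) (by linarith)).2
    (Set.mem_Ici.2 (sq_nonneg ‖a + b‖)) (Set.mem_Ici.2 (sq_nonneg ‖a - b‖))
    (show (0 : ℝ) ≤ 1 / 2 by norm_num) (show (0 : ℝ) ≤ 1 / 2 by norm_num) (by norm_num)
  simp only [smul_eq_mul, aux_par] at h2
  simp only [aux_pow r]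
  linarith

lemma aux_lt {r : ℝ} (hr0 : 0 < r) (hr : r < 2) {a b : ℂ} (h : a * b ≠ 0) :
    ‖a + b‖ ^ r + ‖a - b‖ ^ r - 2 * (‖a‖ ^ r + ‖b‖ ^ r) < 0 := by
  obtain ⟨ha, hb⟩ := mul_ne_zero_iff.1 h
  have h1 := aux_sub (q := r / 2) (by linarith) (by linarith) (pow_pos (norm_pos_iff.2 ha) 2)
    (pow_pos (norm_pos_iff.2 hb) 2)
  have h2 := (Real.concaveOn_rpow (p := r / 2) (by linarith) (by linarith)).2
    (Set.mem_Ici.2 (sq_nonneg ‖a + b‖)) (Set.mem_Ici.2 (sq_nonneg ‖a - b‖))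
    (show (0 : ℝ) ≤ 1 / 2 by norm_num) (show (0 : ℝ) ≤ 1 / 2 by norm_num) (by norm_num)
  simp only [smul_eq_mul, aux_par] at h2
  simp only [aux_pow r]
  linarith

lemma aux_norm {X : Type*} [MeasurableSpace X] {μ : Measure X} {p : ℝ≥0∞}
    (hp0 : p ≠ 0) (hptop : p ≠ ∞) (f : Lp ℂ p μ) :
    ‖f‖ ^ p.toReal = ∫ x, ‖f x‖ ^ p.toReal ∂μ := by
  have hr : 0 < p.toReal := ENNReal.toReal_pos hp0 hptop
  rw [Lp.norm_def, toReal_eLpNorm (Lp.aestronglyMeasurable f),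
    lpNorm_eq_integral_norm_rpow_toReal hp0 hptop (Lp.aestronglyMeasurable f),
    ← Real.rpow_mul (by positivity), inv_mul_cancel₀ hr.ne', Real.rpow_one]

/-- Equality condition in the classical Clarkson inequality: for `f, g ∈ L^p(μ; ℂ)`
with `1 ≤ p < ∞`, `p ≠ 2`, one has
`‖f+g‖_p^p + ‖f−g‖_p^p = 2(‖f‖_p^p + ‖g‖_p^p)` iff `f·g = 0` a.e. -/
theorem stmt2 {X : Type*} [MeasurableSpace X] (μ : Measure X) (p : ℝ≥0∞)
    (hp1 : 1 ≤ p) (hptop : p ≠ ∞) (hp2 : p ≠ 2)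
    (f g : Lp ℂ p μ) :
    ‖f + g‖ ^ p.toReal + ‖f - g‖ ^ p.toReal
        = 2 * (‖f‖ ^ p.toReal + ‖g‖ ^ p.toReal)
      ↔ (∀ᵐ x ∂μ, f x * g x = 0) := by
  have hp0 : p ≠ 0 := (zero_lt_one.trans_le hp1).ne'
  have hr : 0 < p.toReal := ENNReal.toReal_pos hp0 hptop
  have hr2 : p.toReal ≠ 2 := by
    intro h
    apply hp2
    rw [← ENNReal.ofReal_toReal hptop, h]; simp
  have I : ∀ u : Lp ℂ p μ, Integrable (fun x => ‖u x‖ ^ p.toReal) μ := fun u =>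
    (Lp.memLp u).integrable_norm_rpow hp0 hptop
  have ea : (fun x => ‖(f + g : Lp ℂ p μ) x‖ ^ p.toReal) =ᵐ[μ]
      fun x => ‖f x + g x‖ ^ p.toReal := by
    filter_upwards [Lp.coeFn_add f g] with x hx
    rw [hx]; rfl
  have es : (fun x => ‖(f - g : Lp ℂ p μ) x‖ ^ p.toReal) =ᵐ[μ]
      fun x => ‖f x - g x‖ ^ p.toReal := by
    filter_upwards [Lp.coeFn_sub f g] with x hx
    rw [hx]; rfl
  have Ia := (I (f + g)).congr ea
  have Is := (I (f - g)).congr es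
  set D : X → ℝ := fun x => ‖f x + g x‖ ^ p.toReal + ‖f x - g x‖ ^ p.toReal
    - 2 * (‖f x‖ ^ p.toReal + ‖g x‖ ^ p.toReal) with hD
  have ID : Integrable D μ := (Ia.add Is).sub (((I f).add (I g)).const_mul 2)
  have key : ∫ x, D x ∂μ = ‖f + g‖ ^ p.toReal + ‖f - g‖ ^ p.toReal
        - 2 * (‖f‖ ^ p.toReal + ‖g‖ ^ p.toReal) := by
    simp only [aux_norm hp0 hptop]
    rw [integral_congr_ae ea, integral_congr_ae es, ← integral_add Ia Is,
      ← integral_add (I f) (I g), ← integral_const_mul]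
    exact integral_sub (Ia.add Is) (((I f).add (I g)).const_mul 2)
  rw [← sub_eq_zero, ← key]
  constructor
  · intro h
    rcases lt_or_gt_of_ne hr2 with h2 | h2
    · have hn : 0 ≤ fun x => - D x := by
        intro x
        by_cases hx : f x * g x = 0
        · simp [hD, aux_zero hr hx]
        · exact neg_nonneg.2 (aux_lt hr h2 hx).le
      have := (integral_eq_zero_iff_of_nonneg hn ID.neg).1 (by rw [integral_neg, h, neg_zero])
      filter_upwards [this] with x hx
      by_contra hne
      have h3 := aux_lt hr h2 hne
      have h4 : - D x = 0 := hx
      simp only [hD] at h4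
      linarith
    · have hn : 0 ≤ D := by
        intro x
        by_cases hx : f x * g x = 0
        · simp [hD, aux_zero hr hx]
        · exact (aux_gt h2 hx).le
      have := (integral_eq_zero_iff_of_nonneg hn ID).1 h
      filter_upwards [this] with x hx
      by_contra hne
      exact (aux_gt h2 hne).ne' hx
  · intro h
    apply integral_eq_zero_of_ae
    filter_upwards [h] with x hx
    exact aux_zero hr hx
end

section
/- Let n ≥ 3 and let ρ : M_n(ℂ) → ℝ be a function such that: (i) ρ(A) ≥ 0 for every PSD matrix A; (ii) ρ(c·A) = c·ρ(A) for every real c ≥ 0 and PSD A; (iii) ρ(A + B) = ρ(A) + ρ(B) whenever A and B are PSD with AB = 0; and (iv) ρ is continuous on the set of PSD matrices. Then there exists a PSD matrix H ∈ M_n(ℂ) such that ρ(A) = Re(tr(H·A)) for every PSD matrix A; in particular ρ(A + B) = ρ(A) + ρ(B) for all PSD A, B. -/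
open Matrix
open scoped ComplexOrder

abbrev GE3 := EuclideanSpace ℝ (Fin 3)

theorem cauchy_unit (g : ℝ → ℝ) (hg : ContinuousOn g (Set.Icc 0 1))
    (hadd : ∀ a b, 0 ≤ a → 0 ≤ b → a + b ≤ 1 → g (a + b) = g a + g b) :
    ∀ t ∈ Set.Icc (0:ℝ) 1, g t = t * g 1 := by
  let k : ℝ → ℝ := fun t => g t - t * g 1
  have hk : ContinuousOn k (Set.Icc 0 1) := hg.sub (by fun_prop)
  have ka : ∀ a b, 0 ≤ a → 0 ≤ b → a + b ≤ 1 → k (a + b) = k a + k b := by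
    intro a b ha hb hab
    simp only [k, hadd a b ha hb hab]; ring
  have k1 : k 1 = 0 := by simp [k]
  obtain ⟨t, ht, hmax⟩ := isCompact_Icc.exists_isMaxOn (⟨0, by simp⟩ : (Set.Icc (0:ℝ) 1).Nonempty) hk
  have hmax' : ∀ s ∈ Set.Icc (0:ℝ) 1, k s ≤ k t := fun s hs => hmax hs
  have hle : k t ≤ 0 := by
    rcases le_total t (1/2) with h | h
    · have h1 := ka t t ht.1 ht.1 (by linarith)
      have h2 := hmax' (t + t) ⟨by linarith [ht.1], by linarith⟩
      linarith
    · have h1 := ka (2*t-1) (1-t) (by linarith) (by linarith [ht.2]) (by linarith [ht.2])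
      have h3 := ka t (1-t) ht.1 (by linarith [ht.2]) (by linarith)
      have h2 := hmax' (2*t-1) ⟨by linarith, by linarith [ht.2]⟩
      rw [show 2*t-1+(1-t) = t by ring] at h1
      rw [show t+(1-t) = 1 by ring] at h3
      linarith
  intro s hs
  have h3 := ka s (1-s) hs.1 (by linarith [hs.2]) (by linarith)
  rw [show s+(1-s) = 1 by ring] at h3
  have h4 := hmax' s hs
  have h5 := hmax' (1-s) ⟨by linarith [hs.2], by linarith [hs.1]⟩
  have : k s = 0 := by linarith
  simp only [k] at this; linarith

/-- standard basis vector -/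
noncomputable abbrev ge (i : Fin 3) : GE3 := EuclideanSpace.single i 1

theorem exists_iso (q : GE3) (hq : ‖q‖ = 1) : ∃ U : GE3 ≃ₗᵢ[ℝ] GE3, U (ge 2) = q ∧
    ∀ i, (U (ge i)) 2 = q i := by
  let R := (ℝ ∙ (ge 2 - q))ᗮ.reflection
  have h2 : R (ge 2) = q := Submodule.reflection_sub (by simp [hq])
  refine ⟨R, h2, fun i => ?_⟩
  have h := R.inner_map_map (R (ge i)) (ge 2)
  have hRR : R (R (ge i)) = ge i := Submodule.reflection_reflection _ _
  rw [h2, hRR] at h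
  simp only [EuclideanSpace.inner_single_left, EuclideanSpace.inner_single_right] at h
  simpa using h.symm

theorem axial (Φ : GE3 → ℝ) (hc : Continuous Φ) (hh : ∀ (c : ℝ) x, Φ (c • x) = c ^ 2 * Φ x)
    (W : ℝ) (hW : ∀ U : GE3 ≃ₗᵢ[ℝ] GE3, ∑ i, Φ (U (ge i)) = W)
    (hax : ∀ x y : GE3, x 0 ^ 2 + x 1 ^ 2 = y 0 ^ 2 + y 1 ^ 2 → x 2 = y 2 → Φ x = Φ y) (x : GE3) :
    Φ x = (W - Φ (ge 2)) / 2 * (x 0 ^ 2 + x 1 ^ 2) + Φ (ge 2) * x 2 ^ 2 := by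
  have hneg : ∀ x, Φ (-x) = Φ x := fun x => by have := hh (-1) x; simpa using this
  have hax2 : ∀ x y : GE3, x 0 ^ 2 + x 1 ^ 2 = y 0 ^ 2 + y 1 ^ 2 → x 2 ^ 2 = y 2 ^ 2 → Φ x = Φ y := by
    intro x y h h'
    rcases sq_eq_sq_iff_eq_or_eq_neg.1 h' with h' | h'
    · exact hax x y h h'
    · rw [← hneg y]; exact hax _ _ (by simpa using h) (by simpa using h')
  let φ : ℝ → ℝ := fun t => Φ !₂[√(1-t), 0, √t]
  have hφc : Continuous φ := by
    apply hc.comp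
    refine (PiLp.continuous_toLp 2 _).comp ?_
    refine continuous_pi fun i => ?_
    fin_cases i <;> simp <;> fun_prop
  have hφ : ∀ x : GE3, ‖x‖ = 1 → Φ x = φ (x 2 ^ 2) := by
    intro x hx
    have h1 : x 0 ^ 2 + x 1 ^ 2 + x 2 ^ 2 = 1 := by
      have := EuclideanSpace.real_norm_sq_eq x
      rw [hx, Fin.sum_univ_three] at this; linarith
    apply hax2
    · simp
      rw [Real.sq_sqrt (by nlinarith [sq_nonneg (x 0), sq_nonneg (x 1)])]; linarith
    · simp [Real.sq_sqrt (sq_nonneg _)]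
  have hsum : ∀ a b c, 0 ≤ a → 0 ≤ b → 0 ≤ c → a + b + c = 1 → φ a + φ b + φ c = W := by
    intro a b c ha hb hc' habc
    have hn : ‖(!₂[√a, √b, √c] : GE3)‖ = 1 := by
      rw [EuclideanSpace.norm_eq, Fin.sum_univ_three]
      simp [Real.sq_sqrt, ha, hb, hc', habc]
    obtain ⟨U, -, hU⟩ := exists_iso _ hn
    have := hW U
    rw [Fin.sum_univ_three, hφ _ (by simp), hφ _ (by simp), hφ _ (by simp), hU, hU, hU] at this
    simpa [Real.sq_sqrt, ha, hb, hc'] using this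
  have h0 := hsum 1 0 0 (by simp) (by simp) (by simp) (by simp)
  have hφ1 : φ 1 = Φ (ge 2) := by
    have := hφ (ge 2) (by simp)
    rw [this]; simp
  have key := cauchy_unit (fun t => φ t - φ 0) (by fun_prop) (by
    intro a b ha hb hab
    have h1 := hsum a b (1-a-b) ha hb (by linarith) (by ring)
    have h2 := hsum (a+b) 0 (1-a-b) (by linarith) (by simp) (by linarith) (by ring)
    linarith)
  rcases eq_or_ne x 0 with rfl | hx
  · have := hh 0 0
    simpa using this
  · have hn : ‖x‖ ≠ 0 := by simpa using hx
    have hxe : x = ‖x‖ • (‖x‖⁻¹ • x) := by rw [smul_smul, mul_inv_cancel₀ hn, one_smul]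
    have hu : ‖(‖x‖⁻¹ • x)‖ = 1 := by rw [norm_smul]; simp [hn]
    have h1 : x 0 ^ 2 + x 1 ^ 2 + x 2 ^ 2 = ‖x‖ ^ 2 := by
      rw [EuclideanSpace.real_norm_sq_eq x, Fin.sum_univ_three]
    have e1 : Φ x = ‖x‖ ^ 2 * φ ((‖x‖⁻¹ * x 2) ^ 2) := by
      conv_lhs => rw [hxe]
      rw [hh, hφ _ hu]; simp
    have hle : (‖x‖⁻¹ * x 2) ^ 2 ≤ 1 := by
      rw [mul_pow, inv_pow, ← div_eq_inv_mul, div_le_one (by positivity)]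
      nlinarith [sq_nonneg (x 0), sq_nonneg (x 1)]
    have e2 := key _ ⟨sq_nonneg _, hle⟩
    simp only at e2
    rw [e1, eq_add_of_sub_eq e2, hφ1]
    have h00 : φ 0 = (W - Φ (ge 2)) / 2 := by rw [← hφ1]; linarith
    rw [h00, show x 0 ^ 2 + x 1 ^ 2 = ‖x‖^2 - x 2 ^ 2 by linarith]
    field_simp
    ring

/-- rotation about the last axis -/
noncomputable def grot (θ : ℝ) : GE3 ≃ₗᵢ[ℝ] GE3 where
  toFun x := !₂[Real.cos θ * x 0 - Real.sin θ * x 1, Real.sin θ * x 0 + Real.cos θ * x 1, x 2]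
  invFun x := !₂[Real.cos θ * x 0 + Real.sin θ * x 1, -Real.sin θ * x 0 + Real.cos θ * x 1, x 2]
  map_add' x y := by
    ext i; fin_cases i <;> simp <;> ring
  map_smul' c x := by
    ext i; fin_cases i <;> simp <;> ring
  left_inv x := by
    have h := Real.cos_sq_add_sin_sq θ
    ext i; fin_cases i <;> simp
    · linear_combination x 0 * h
    · linear_combination x 1 * h
  right_inv x := by
    have h := Real.cos_sq_add_sin_sq θ
    ext i; fin_cases i <;> simp
    · linear_combination x 0 * h
    · linear_combination x 1 * h
  norm_map' x := by
    have h := Real.cos_sq_add_sin_sq θ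
    rw [EuclideanSpace.norm_eq, EuclideanSpace.norm_eq, Fin.sum_univ_three, Fin.sum_univ_three]
    congr 1
    simp
    linear_combination (x 0 ^ 2 + x 1 ^ 2) * h

theorem grot_apply (θ : ℝ) (x : GE3) : grot θ x =
  !₂[Real.cos θ * x 0 - Real.sin θ * x 1, Real.sin θ * x 0 + Real.cos θ * x 1, x 2] := rfl

theorem grot_cont : Continuous (fun p : ℝ × GE3 => grot p.1 p.2) := by
  simp only [grot_apply]
  refine (PiLp.continuous_toLp 2 _).comp ?_
  refine continuous_pi fun i => ?_
  fin_cases i <;> simp <;> fun_prop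

theorem grot_cont' : Continuous (fun p : GE3 × ℝ => grot p.2 p.1) := by
  simp only [grot_apply]
  refine (PiLp.continuous_toLp 2 _).comp ?_
  refine continuous_pi fun i => ?_
  fin_cases i <;> simp <;> fun_prop

theorem grot_contl (x : GE3) : Continuous (fun θ : ℝ => grot θ x) := by
  simp only [grot_apply]
  refine (PiLp.continuous_toLp 2 _).comp ?_
  refine continuous_pi fun i => ?_
  fin_cases i <;> simp <;> fun_prop

theorem grot_e2 (θ : ℝ) : grot θ (ge 2) = ge 2 := by
  rw [grot_apply]; ext i; fin_cases i <;> simp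

theorem exists_polar (x : GE3) : ∃ α : ℝ, x = grot α !₂[√(x 0 ^ 2 + x 1 ^ 2), 0, x 2] := by
  refine ⟨Complex.arg ⟨x 0, x 1⟩, ?_⟩
  have h : ‖(⟨x 0, x 1⟩ : ℂ)‖ = √(x 0 ^ 2 + x 1 ^ 2) := by
    rw [Complex.norm_eq_sqrt_sq_add_sq]
  have h1 := Complex.norm_mul_cos_arg ⟨x 0, x 1⟩
  have h2 := Complex.norm_mul_sin_arg ⟨x 0, x 1⟩
  rw [h] at h1 h2
  rw [grot_apply]
  ext i; fin_cases i <;> simp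
  · simp only at h1; linarith
  · simp only at h2; linarith

theorem grot_grot (θ α : ℝ) (x : GE3) : grot θ (grot α x) = grot (θ + α) x := by
  simp only [grot_apply, Real.cos_add, Real.sin_add]
  ext i; fin_cases i <;> simp <;> ring

open MeasureTheory in
theorem circle_mean (F : GE3 → ℝ) (hc : Continuous F) (hh : ∀ (c : ℝ) x, F (c • x) = c ^ 2 * F x)
    (w : ℝ) (hw : ∀ U : GE3 ≃ₗᵢ[ℝ] GE3, ∑ i, F (U (ge i)) = w) (U : GE3 ≃ₗᵢ[ℝ] GE3) (x : GE3) :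
    ∫ θ in (0:ℝ)..(2 * Real.pi), F (U (grot θ x)) =
      2 * Real.pi * ((w - F (U (ge 2))) / 2 * (x 0 ^ 2 + x 1 ^ 2) + F (U (ge 2)) * x 2 ^ 2) := by
  have hcc : Continuous (fun p : GE3 × ℝ => F (U (grot p.2 p.1))) :=
    hc.comp (U.continuous.comp grot_cont')
  have hct : ∀ x, Continuous (fun θ : ℝ => F (U (grot θ x))) := by
    intro x
    exact hc.comp (U.continuous.comp (grot_contl x))
  let Φ : GE3 → ℝ := fun x => ∫ θ in (0:ℝ)..(2 * Real.pi), F (U (grot θ x))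
  have hΦ2 : Φ (ge 2) = 2 * Real.pi * F (U (ge 2)) := by
    simp only [Φ, grot_e2]; simp
  have key := axial Φ
    (intervalIntegral.continuous_parametric_intervalIntegral_of_continuous'
      (f := fun x θ => F (U (grot θ x))) hcc 0 (2 * Real.pi))
    (by intro c x
        simp only [Φ, map_smul, hh, intervalIntegral.integral_const_mul])
    (2 * Real.pi * w)
    (by intro V
        simp only [Φ]
        rw [← intervalIntegral.integral_finsetSum (fun i _ => (hct _).intervalIntegrable _ _)]
        have : ∀ θ, ∑ i, F (U (grot θ (V (ge i)))) = w := fun θ =>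
          hw ((V.trans (grot θ)).trans U)
        simp only [this]; simp)
    (by intro x y hxy hz
        have red : ∀ x : GE3, Φ x = Φ !₂[√(x 0 ^ 2 + x 1 ^ 2), 0, x 2] := by
          intro x
          obtain ⟨α, hα⟩ := exists_polar x
          conv_lhs => rw [hα]
          simp only [Φ, grot_grot]
          rw [intervalIntegral.integral_comp_add_right
            (fun θ => F (U (grot θ !₂[√(x 0 ^ 2 + x 1 ^ 2), 0, x 2])))]
          have hp : Function.Periodic
            (fun θ => F (U (grot θ !₂[√(x 0 ^ 2 + x 1 ^ 2), 0, x 2]))) (2 * Real.pi) := by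
            intro θ
            simp only [grot_apply, Real.cos_add_two_pi, Real.sin_add_two_pi]
          have := hp.intervalIntegral_add_eq α 0
          rw [zero_add (2 * Real.pi)] at this
          rw [zero_add, add_comm (2 * Real.pi) α]
          exact this
        rw [red x, red y, hxy, hz]) x
  change Φ x = _
  rw [key, hΦ2]; ring

/-- radial weight -/
noncomputable def gwt (x : GE3) : ℝ := max 0 (1 - ‖x‖)

theorem gwt_cont : Continuous gwt := by unfold gwt; fun_prop

theorem gwt_supp : HasCompactSupport gwt := by
  refine HasCompactSupport.intro (isCompact_closedBall (0:GE3) 1) fun x hx => ?_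
  have : 1 < ‖x‖ := by simpa using hx
  simp [gwt, this.le]

theorem gwt_iso (U : GE3 ≃ₗᵢ[ℝ] GE3) (x : GE3) : gwt (U x) = gwt x := by simp [gwt]

open MeasureTheory

theorem gwt_int (f : GE3 → ℝ) (hf : Continuous f) : Integrable (fun x => gwt x * f x) :=
  (gwt_cont.mul hf).integrable_of_hasCompactSupport gwt_supp.mul_right

theorem gint_iso (U : GE3 ≃ₗᵢ[ℝ] GE3) (f : GE3 → ℝ) :
    ∫ x, gwt x * f (U x) = ∫ x, gwt x * f x := by
  have := U.measurePreserving.integral_comp U.toHomeomorph.measurableEmbedding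
    (fun x => gwt x * f x)
  simpa [gwt_iso] using this

theorem gconst_pos : 0 < (∫ x, gwt x * (x 2 ^ 2 * x 2 ^ 2)) -
    (∫ x, gwt x * (x 2 ^ 2 * (x 0 ^ 2 + x 1 ^ 2))) / 2 := by
  let S : Equiv.Perm (Fin 3) → (GE3 ≃ₗᵢ[ℝ] GE3) := fun σ =>
    LinearIsometryEquiv.piLpCongrLeft 2 ℝ ℝ σ
  have i1 : ∫ x, gwt x * (x 2 ^ 2 * x 1 ^ 2) = ∫ x, gwt x * (x 2 ^ 2 * x 0 ^ 2) := by
    rw [← gint_iso (S (Equiv.swap 0 1)) (fun x => x 2 ^ 2 * x 0 ^ 2)]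
    rfl
  have i2 : ∫ x, gwt x * (x 2 ^ 2 * x 2 ^ 2) = ∫ x, gwt x * (x 0 ^ 2 * x 0 ^ 2) := by
    rw [← gint_iso (S (Equiv.swap 0 2)) (fun x => x 0 ^ 2 * x 0 ^ 2)]
    rfl
  have hpos : 0 < ∫ x, gwt x * ((x 0 ^ 2 - x 2 ^ 2) ^ 2) := by
    refine Continuous.integral_pos_of_hasCompactSupport_nonneg_nonzero (x := (1/2 : ℝ) • ge 0)
      (gwt_cont.mul (by fun_prop)) gwt_supp.mul_right
      (fun x => mul_nonneg (le_max_left _ _) (sq_nonneg _)) ?_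
    simp [gwt, norm_smul]
    norm_num
  have e : ∀ f g : GE3 → ℝ, Continuous f → Continuous g → ∫ x, gwt x * (f x + g x) =
      (∫ x, gwt x * f x) + ∫ x, gwt x * g x := by
    intro f g hf hg
    simp only [mul_add]
    exact integral_add (gwt_int f hf) (gwt_int g hg)
  have e1 : ∫ x, gwt x * (x 2 ^ 2 * (x 0 ^ 2 + x 1 ^ 2)) =
    (∫ x, gwt x * (x 2 ^ 2 * x 0 ^ 2)) + ∫ x, gwt x * (x 2 ^ 2 * x 1 ^ 2) := by
    simp only [mul_add (_ ^ 2)]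
    exact e _ _ (by fun_prop) (by fun_prop)
  have e2 : ∫ x, gwt x * ((x 0 ^ 2 - x 2 ^ 2) ^ 2) =
    (∫ x, gwt x * (x 0 ^ 2 * x 0 ^ 2)) + ((∫ x, gwt x * (x 2 ^ 2 * x 2 ^ 2))
      + ((-2) * ∫ x, gwt x * (x 2 ^ 2 * x 0 ^ 2))) := by
    rw [← integral_const_mul, ← integral_add, ← integral_add]
    · congr 1; ext x; ring
    · exact gwt_int _ (by fun_prop)
    · exact (gwt_int _ (by fun_prop)).add ((gwt_int _ (by fun_prop)).const_mul _)
    · exact gwt_int _ (by fun_prop)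
    · exact (gwt_int _ (by fun_prop)).const_mul _
  rw [e1, i1]
  linarith

theorem real_gleason (F : GE3 → ℝ) (hc : Continuous F)
    (hh : ∀ (c : ℝ) x, F (c • x) = c ^ 2 * F x)
    (w : ℝ) (hw : ∀ U : GE3 ≃ₗᵢ[ℝ] GE3, ∑ i, F (U (ge i)) = w) :
    ∃ Q : Fin 3 → Fin 3 → ℝ, ∀ p : GE3, F p = ∑ i, ∑ j, Q i j * (p i * p j) := by
  set I4 := ∫ x, gwt x * (x 2 ^ 2 * x 2 ^ 2) with hI4
  set I2 := ∫ x, gwt x * (x 2 ^ 2 * (x 0 ^ 2 + x 1 ^ 2)) with hI2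
  have hI := gconst_pos
  rw [← hI4, ← hI2] at hI
  let K : GE3 → ℝ := fun p => ∫ x, gwt x * ((inner ℝ p x) ^ 2 * F x)
  have hK1 : ∀ p, ‖p‖ = 1 → K p = (I4 - I2 / 2) * F p + w / 2 * I2 := by
    intro p hp
    obtain ⟨U, hU, -⟩ := exists_iso p hp
    have hθ : ∀ θ, K p = ∫ x, gwt x * (x 2 ^ 2 * F (U (grot θ x))) := by
      intro θ
      simp only [K]
      rw [← gint_iso ((grot θ).trans U)]
      have hp' : p = ((grot θ).trans U) (ge 2) := by simp [grot_e2, hU]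
      have : ∀ x, inner ℝ p (((grot θ).trans U) x) = x 2 := by
        intro x
        conv_lhs => rw [hp']
        rw [LinearIsometryEquiv.inner_map_map, EuclideanSpace.inner_single_left]; simp
      simp only [this]
      rfl
    have hcc : Continuous (fun q : ℝ × GE3 => F (U (grot q.1 q.2))) :=
      hc.comp (U.continuous.comp grot_cont)
    have hsw := intervalIntegral_integral_swap (μ := (volume : Measure GE3)) (a := 0)
      (b := 2 * Real.pi) (f := fun θ x => gwt x * (x 2 ^ 2 * F (U (grot θ x)))) (by
        have hcont : Continuous (fun q : ℝ × GE3 =>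
            gwt q.2 * (q.2 2 ^ 2 * F (U (grot q.1 q.2)))) :=
          (gwt_cont.comp continuous_snd).mul ((by fun_prop : Continuous (fun q : ℝ × GE3 => q.2 2 ^ 2)).mul hcc)
        have h1 : IntegrableOn (fun q : ℝ × GE3 =>
            gwt q.2 * (q.2 2 ^ 2 * F (U (grot q.1 q.2))))
            (Set.uIcc 0 (2*Real.pi) ×ˢ Metric.closedBall 0 1) (volume.prod volume) :=
          hcont.continuousOn.integrableOn_compact (isCompact_uIcc.prod (isCompact_closedBall _ _))
        have h2 : IntegrableOn (fun q : ℝ × GE3 =>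
            gwt q.2 * (q.2 2 ^ 2 * F (U (grot q.1 q.2))))
            (Set.uIoc 0 (2*Real.pi) ×ˢ Set.univ) (volume.prod volume) := by
          refine IntegrableOn.of_forall_sdiff_eq_zero
            (h1.mono_set (Set.prod_mono_left Set.uIoc_subset_uIcc))
            (measurableSet_uIoc.prod MeasurableSet.univ) ?_
          rintro ⟨θ, x⟩ ⟨⟨a, -⟩, b⟩
          have hx : x ∉ Metric.closedBall (0:GE3) 1 := fun h => b ⟨a, h⟩
          have : 1 < ‖x‖ := by simpa using hx
          simp [gwt, this.le]
        rw [IntegrableOn, ← Measure.prod_restrict, Measure.restrict_univ] at h2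
        exact h2)
    simp only [← hθ] at hsw
    simp only [intervalIntegral.integral_const_mul, circle_mean F hc hh w hw U, hU] at hsw
    rw [intervalIntegral.integral_const] at hsw
    have hr : ∫ x : GE3, gwt x * (x 2 ^ 2 * (2 * Real.pi * ((w - F p) / 2 * (x 0 ^ 2 + x 1 ^ 2)
        + F p * x 2 ^ 2))) = 2 * Real.pi * ((w - F p) / 2) * I2 + 2 * Real.pi * F p * I4 := by
      rw [hI2, hI4, ← integral_const_mul, ← integral_const_mul, ← integral_add]
      · congr 1; ext x; ring
      · exact (gwt_int _ (by fun_prop)).const_mul _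
      · exact (gwt_int _ (by fun_prop)).const_mul _
    rw [hr] at hsw
    have hpi := Real.pi_pos
    simp only [sub_zero, smul_eq_mul] at hsw
    apply mul_left_cancel₀ (show 2 * Real.pi ≠ 0 by positivity)
    rw [hsw]; ring
  have hKh : ∀ (c : ℝ) p, K (c • p) = c ^ 2 * K p := by
    intro c p
    simp only [K, inner_smul_left]
    rw [← integral_const_mul]
    congr 1; ext x; simp; ring
  have hK : ∀ p, K p = (I4 - I2 / 2) * F p + w / 2 * I2 * ∑ i, p i ^ 2 := by
    intro p
    rw [← EuclideanSpace.real_norm_sq_eq p]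
    rcases eq_or_ne p 0 with rfl | hx
    · have := hh 0 0
      have h' := hKh 0 0
      simp at this h'
      simp [this, h']
    · have hn : ‖p‖ ≠ 0 := by simpa using hx
      have hxe : p = ‖p‖ • (‖p‖⁻¹ • p) := by rw [smul_smul, mul_inv_cancel₀ hn, one_smul]
      have hu : ‖(‖p‖⁻¹ • p)‖ = 1 := by rw [norm_smul]; simp [hn]
      have e1 := hK1 _ hu
      rw [hKh, hh] at e1
      field_simp at e1
      linarith
  have hKq : ∀ p, K p = ∑ i, ∑ j, (∫ x, gwt x * (x i * x j * F x)) * (p i * p j) := by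
    intro p
    simp only [K, mul_comm _ (p _ * p _)]
    simp only [← integral_const_mul]
    have hii : ∀ i j, Integrable (fun x : GE3 => p i * p j * (gwt x * (x i * x j * F x))) :=
      fun i j => (gwt_int _ (by fun_prop)).const_mul _
    simp_rw [← integral_finsetSum Finset.univ (fun j _ => hii _ j)]
    rw [← integral_finsetSum Finset.univ
      (fun i _ => integrable_finsetSum Finset.univ (fun j _ => hii i j))]
    congr 1; ext x
    simp [Fin.sum_univ_three, PiLp.inner_apply]
    ring
  refine ⟨fun i j => (I4 - I2 / 2)⁻¹ * ((∫ x, gwt x * (x i * x j * F x))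
    - if i = j then w / 2 * I2 else 0), fun p => ?_⟩
  have h1 := hK p
  rw [hKq p] at h1
  apply mul_left_cancel₀ hI.ne'
  rw [← sub_eq_iff_eq_add] at h1
  rw [← h1]
  generalize I4 - I2 / 2 = D at hI
  have hD : ∀ a b, D * (D⁻¹ * a * b) = a * b := by
    intro a b; field_simp
  simp only [Finset.mul_sum, hD]
  simp [Fin.sum_univ_three]
  ring

section cplx
variable {E : Type*} [NormedAddCommGroup E] [InnerProductSpace ℂ E] [FiniteDimensional ℂ E]

theorem exists_third (hE : 3 ≤ Module.finrank ℂ E) (x y : E) :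
    ∃ z : E, ‖z‖ = 1 ∧ inner ℂ x z = 0 ∧ inner ℂ y z = 0 := by
  let S := Submodule.span ℂ (Set.range ![x, y])
  have h1 : Module.finrank ℂ S ≤ 2 := by
    exact (finrank_range_le_card (R := ℂ) ![x, y]).trans (by simp)
  have h2 := S.finrank_add_finrank_orthogonal
  have h3 : 0 < Module.finrank ℂ Sᗮ := by omega
  haveI := Module.finrank_pos_iff.1 h3
  obtain ⟨z, hz⟩ := exists_norm_eq Sᗮ (zero_le_one)
  have hm := (Submodule.mem_orthogonal S z).1 z.2
  exact ⟨z, hz, hm _ (Submodule.subset_span ⟨0, rfl⟩), hm _ (Submodule.subset_span ⟨1, rfl⟩)⟩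

theorem pair_quad (hE : 3 ≤ Module.finrank ℂ E) (F : E → ℝ) (hc : Continuous F)
    (hh : ∀ (c : ℂ) x, F (c • x) = ‖c‖ ^ 2 * F x)
    (hfr : ∀ u : Fin 3 → E, Orthonormal ℂ u → ∃ w, ∀ U : GE3 ≃ₗᵢ[ℝ] GE3,
      ∑ i, F (∑ j, ((U (ge i) j : ℝ) : ℂ) • u j) = w)
    (x y : E) (hx : ‖x‖ = 1) (hy : ‖y‖ = 1) (hxy : inner ℂ x y = 0) :
    ∃ c : ℝ, ∀ a b : ℝ, F ((a : ℂ) • x + (b : ℂ) • y) = a ^ 2 * F x + b ^ 2 * F y + a * b * c := by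
  obtain ⟨z, hz, hxz, hyz⟩ := exists_third hE x y
  have hyx : inner ℂ y x = 0 := inner_eq_zero_symm.1 hxy
  have hzx : inner ℂ z x = 0 := inner_eq_zero_symm.1 hxz
  have hzy : inner ℂ z y = 0 := inner_eq_zero_symm.1 hyz
  have hu : Orthonormal ℂ ![x, y, z] := by
    constructor
    · intro i; fin_cases i <;> simp [hx, hy, hz]
    · intro i j hij
      fin_cases i <;> fin_cases j <;> simp_all
  obtain ⟨w, hw⟩ := hfr _ hu
  obtain ⟨Q, hQ⟩ := real_gleason (fun p => F (∑ j, ((p j : ℝ) : ℂ) • ![x, y, z] j))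
    (by fun_prop)
    (by intro c p
        have : ∑ j, (((c • p) j : ℝ) : ℂ) • ![x, y, z] j = (c : ℂ) • ∑ j, ((p j : ℝ) : ℂ) • ![x, y, z] j := by
          rw [Finset.smul_sum]
          refine Finset.sum_congr rfl fun j _ => ?_
          rw [smul_smul, ← Complex.ofReal_mul]; rfl
        simp only [this, hh]; simp)
    w hw
  have key : ∀ a b : ℝ, F ((a : ℂ) • x + (b : ℂ) • y) =
      a ^ 2 * Q 0 0 + b ^ 2 * Q 1 1 + a * b * (Q 0 1 + Q 1 0) := by
    intro a b
    have := hQ !₂[a, b, 0]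
    simp [Fin.sum_univ_three] at this
    rw [Complex.coe_smul, Complex.coe_smul, this]; ring
  refine ⟨Q 0 1 + Q 1 0, fun a b => ?_⟩
  have k1 := key 1 0
  have k2 := key 0 1
  simp at k1 k2
  rw [key, k1, k2]

theorem max_split (hE : 3 ≤ Module.finrank ℂ E) (F : E → ℝ) (hc : Continuous F)
    (hh : ∀ (c : ℂ) x, F (c • x) = ‖c‖ ^ 2 * F x)
    (hfr : ∀ u : Fin 3 → E, Orthonormal ℂ u → ∃ w, ∀ U : GE3 ≃ₗᵢ[ℝ] GE3,
      ∑ i, F (∑ j, ((U (ge i) j : ℝ) : ℂ) • u j) = w)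
    (S : Submodule ℂ E) (x : E) (hxS : x ∈ S) (hx : ‖x‖ = 1)
    (hmax : ∀ y ∈ S, ‖y‖ = 1 → F y ≤ F x) (a : ℂ) (y : E) (hy : y ∈ S) (hxy : inner ℂ x y = 0) :
    F (a • x + y) = ‖a‖ ^ 2 * F x + F y := by
  have hF0 : F 0 = 0 := by have := hh 0 0; simpa using this
  have hmax' : ∀ y ∈ S, F y ≤ ‖y‖ ^ 2 * F x := by
    intro y hy
    rcases eq_or_ne y 0 with rfl | h0
    · simp [hF0]
    · have hn : ‖y‖ ≠ 0 := by simpa using h0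
      have hye : y = (‖y‖ : ℂ) • (((‖y‖⁻¹ : ℝ) : ℂ) • y) := by
        rw [smul_smul, ← Complex.ofReal_mul, mul_inv_cancel₀ hn]; simp
      have := hmax (((‖y‖⁻¹ : ℝ) : ℂ) • y) (S.smul_mem _ hy) (by rw [norm_smul]; simp [hn])
      conv_lhs => rw [hye]
      rw [hh]
      simp only [Complex.norm_real, norm_norm]
      gcongr
  rcases eq_or_ne y 0 with rfl | hy0
  · simp [hh, hF0]
  have hn : ‖y‖ ≠ 0 := by simpa using hy0
  rcases eq_or_ne a 0 with rfl | ha0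
  · simp
  have han : ‖a‖ ≠ 0 := by simpa using ha0
  have hanc : (‖a‖ : ℂ) ≠ 0 := by exact_mod_cast han
  have hnc : (‖y‖ : ℂ) ≠ 0 := by exact_mod_cast hn
  -- normalised second vector
  let y' : E := ((‖a‖ : ℂ) / (a * ‖y‖)) • y
  have hy'S : y' ∈ S := S.smul_mem _ hy
  have hy'n : ‖y'‖ = 1 := by
    simp only [y', norm_smul, norm_div, norm_mul, Complex.norm_real, norm_norm]
    field_simp
  have hxy' : inner ℂ x y' = 0 := by simp [y', inner_smul_right, hxy]
  have hdec : a • x + y = (a / ‖a‖) • ((‖a‖ : ℂ) • x + (‖y‖ : ℂ) • y') := by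
    simp only [y', smul_add, smul_smul]
    congr 1
    · congr 1; field_simp
    · conv_lhs => rw [← one_smul ℂ y]
      congr 1; field_simp
  have hyd : y = (a / ‖a‖ * ‖y‖) • y' := by
    simp only [y', smul_smul]
    conv_lhs => rw [← one_smul ℂ y]
    congr 1; field_simp
  obtain ⟨c, hcq⟩ := pair_quad hE F hc hh hfr x y' hx hy'n hxy'
  have hc0 : c = 0 := by
    by_contra hc0
    have hb : ∀ b : ℝ, b ^ 2 * (F y' - F x) + b * c ≤ 0 := by
      intro b
      have h1 := hmax' _ (S.add_mem (S.smul_mem ((1:ℝ):ℂ) hxS) (S.smul_mem (b:ℂ) hy'S))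
      rw [hcq] at h1
      have h2 : ‖((1:ℝ):ℂ) • x + (b:ℂ) • y'‖ ^ 2 = 1 + b ^ 2 := by
        have := norm_add_sq_eq_norm_sq_add_norm_sq_of_inner_eq_zero (𝕜 := ℂ) (((1:ℝ):ℂ) • x) ((b:ℂ) • y')
          (by simp [inner_smul_left, inner_smul_right, hxy'])
        rw [sq, this]
        simp [norm_smul, hx, hy'n, sq]
      rw [h2] at h1
      linarith
    have hD : F y' - F x ≤ 0 := by linarith [hmax y' hy'S hy'n]
    have hp : 0 < 1 - (F y' - F x) := by linarith
    have h := hb (c / (1 - (F y' - F x)))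
    generalize F y' - F x = D at *
    have : (c / (1 - D)) ^ 2 * D + c / (1 - D) * c = c ^ 2 / (1 - D) ^ 2 := by
      field_simp; ring
    rw [this] at h
    have : 0 < c ^ 2 / (1 - D) ^ 2 := by positivity
    linarith
  rw [hdec, hh, hcq, hc0]
  have hFy : F y = ‖a / ‖a‖ * ‖y‖‖ ^ 2 * F y' := by
    conv_lhs => rw [hyd]
    rw [hh]
  rw [hFy]
  generalize F y' = q
  simp [han]

theorem exists_list (hE : 3 ≤ Module.finrank ℂ E) (F : E → ℝ) (hc : Continuous F)
    (h0 : ∀ x, 0 ≤ F x)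
    (hh : ∀ (c : ℂ) x, F (c • x) = ‖c‖ ^ 2 * F x)
    (hfr : ∀ u : Fin 3 → E, Orthonormal ℂ u → ∃ w, ∀ U : GE3 ≃ₗᵢ[ℝ] GE3,
      ∑ i, F (∑ j, ((U (ge i) j : ℝ) : ℂ) • u j) = w) (k : ℕ) :
    ∀ S : Submodule ℂ E, Module.finrank ℂ S = k → ∃ l : List E, (∀ v ∈ l, v ∈ S) ∧
      ∀ x ∈ S, F x = (l.map fun v => ‖inner ℂ v x‖ ^ 2).sum := by
  have hF0 : F 0 = 0 := by have := hh 0 0; simpa using this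
  induction k with
  | zero =>
    intro S hS
    have : S = ⊥ := Submodule.finrank_eq_zero.1 hS
    subst this
    refine ⟨[], by simp, ?_⟩
    intro x hx
    rw [(Submodule.mem_bot ℂ).1 hx]; simpa using hF0
  | succ k ih =>
    intro S hS
    have h3 : 0 < Module.finrank ℂ S := by omega
    haveI := Module.finrank_pos_iff.1 h3
    haveI : ProperSpace S := FiniteDimensional.proper ℂ S
    obtain ⟨z, hz⟩ := exists_norm_eq S (zero_le_one)
    obtain ⟨x, hx, hmax⟩ := (isCompact_sphere (0 : S) 1).exists_isMaxOn ⟨z, by simpa using hz⟩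
      (f := fun x : S => F x) (by fun_prop)
    have hx1 : ‖(x : E)‖ = 1 := by simpa using hx
    have hmax' : ∀ y ∈ S, ‖y‖ = 1 → F y ≤ F x := by
      intro y hy hy1
      exact hmax (show (⟨y, hy⟩ : S) ∈ Metric.sphere (0:S) 1 by simpa using hy1)
    have hspl := max_split hE F hc hh hfr S x x.2 hx1 hmax'
    let T : Submodule ℂ E := (ℂ ∙ (x : E))ᗮ ⊓ S
    have hT : Module.finrank ℂ T = k := by
      have h1 := Submodule.finrank_add_inf_finrank_orthogonal
        (K₁ := ℂ ∙ (x : E)) (K₂ := S) (by simp)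
      have h2 : Module.finrank ℂ (ℂ ∙ (x : E)) = 1 :=
        finrank_span_singleton (by intro h; simp [h] at hx1)
      simp only [T]
      omega
    obtain ⟨l, hl, hlF⟩ := ih T hT
    have hTo : ∀ v ∈ T, inner ℂ (x : E) v = 0 := fun v hv =>
      Submodule.mem_orthogonal_singleton_iff_inner_right.1 hv.1
    refine ⟨((√(F x) : ℝ) : ℂ) • (x : E) :: l, ?_, ?_⟩
    · intro v hv
      rcases List.mem_cons.1 hv with rfl | hv
      · exact S.smul_mem _ x.2
      · exact (hl v hv).2
    · intro y hy
      let a := inner ℂ (x : E) y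
      let t := y - a • (x : E)
      have hxx : inner ℂ (x : E) (x : E) = 1 := by
        rw [inner_self_eq_norm_sq_to_K, hx1]; simp
      have htx : inner ℂ (x : E) t = 0 := by
        simp only [t, inner_sub_right, inner_smul_right, hxx, a]; simp
      have htS : t ∈ S := S.sub_mem hy (S.smul_mem _ x.2)
      have htT : t ∈ T := ⟨Submodule.mem_orthogonal_singleton_iff_inner_right.2 htx, htS⟩
      have hyt : y = a • (x : E) + t := by simp [t]
      have e1 := hspl a t htS htx
      rw [← hyt] at e1
      rw [e1, hlF t htT, List.map_cons, List.sum_cons]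
      congr 1
      · rw [inner_smul_left]
        simp [mul_pow, Real.sq_sqrt (h0 _), a, mul_comm]
      · congr 1
        refine List.map_congr_left fun v hv => ?_
        rw [hyt, inner_add_right, inner_smul_right, inner_eq_zero_symm.1 (hTo v (hl v hv))]
        simp
end cplx

theorem ortho_sum {n : ℕ} (ρ : Matrix (Fin n) (Fin n) ℂ → ℝ)
    (h2 : ∀ (c : ℝ) (A : Matrix (Fin n) (Fin n) ℂ), 0 ≤ c → A.PosSemidef →
      ρ ((c : ℂ) • A) = c * ρ A)
    (h3 : ∀ A B : Matrix (Fin n) (Fin n) ℂ, A.PosSemidef → B.PosSemidef → A * B = 0 →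
      ρ (A + B) = ρ A + ρ B) {ι : Type*} (s : Finset ι) (B : ι → Matrix (Fin n) (Fin n) ℂ)
    (hB : ∀ i, (B i).PosSemidef) (hBB : ∀ i j, i ≠ j → B i * B j = 0) :
    ρ (∑ i ∈ s, B i) = ∑ i ∈ s, ρ (B i) := by
  classical
  induction s using Finset.induction_on with
  | empty =>
    have := h2 0 0 le_rfl Matrix.PosSemidef.zero
    simpa using this
  | insert a s ha ih =>
    rw [Finset.sum_insert ha, Finset.sum_insert ha, h3 _ _ (hB a)
      (Matrix.posSemidef_sum _ fun i _ => hB i), ih]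
    rw [Finset.mul_sum]
    refine Finset.sum_eq_zero fun i hi => hBB a i ?_
    rintro rfl; exact ha hi

/-- rank one matrix -/
noncomputable def rk1 {n : ℕ} (x : EuclideanSpace ℂ (Fin n)) : Matrix (Fin n) (Fin n) ℂ :=
  vecMulVec x.ofLp (star x.ofLp)

theorem rk1_psd {n : ℕ} (x : EuclideanSpace ℂ (Fin n)) : (rk1 x).PosSemidef :=
  posSemidef_vecMulVec_self_star _

theorem rk1_mul {n : ℕ} (x y : EuclideanSpace ℂ (Fin n)) :
    rk1 x * rk1 y = inner ℂ x y • vecMulVec x.ofLp (star y.ofLp) := by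
  rw [rk1, rk1, vecMulVec_mul_vecMulVec, EuclideanSpace.inner_eq_star_dotProduct, dotProduct_comm]
  ext i j; simp [vecMulVec_apply]; ring

theorem rk1_trace {n : ℕ} (x y : EuclideanSpace ℂ (Fin n)) :
    ((rk1 x * rk1 y).trace).re = ‖inner ℂ x y‖ ^ 2 := by
  rw [rk1_mul, trace_smul, trace_vecMulVec, smul_eq_mul]
  have : x.ofLp ⬝ᵥ star y.ofLp = inner ℂ y x := by
    rw [EuclideanSpace.inner_eq_star_dotProduct]
  rw [this, ← inner_conj_symm y x, Complex.mul_conj, Complex.normSq_eq_norm_sq]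
  simp [← Complex.ofReal_pow]

theorem rk1_smul {n : ℕ} (c : ℂ) (x : EuclideanSpace ℂ (Fin n)) :
    rk1 (c • x) = ((‖c‖ ^ 2 : ℝ) : ℂ) • rk1 x := by
  rw [← Complex.normSq_eq_norm_sq, ← Complex.mul_conj]
  ext i j; simp [rk1, vecMulVec_apply]; ring

theorem rk1_cont {n : ℕ} : Continuous (rk1 (n := n)) := by
  unfold rk1
  refine continuous_matrix fun i j => ?_
  simp only [vecMulVec_apply, Pi.star_apply]
  fun_prop

theorem iso_ortho (U : GE3 ≃ₗᵢ[ℝ] GE3) (j k : Fin 3) :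
    ∑ i, U (ge i) j * U (ge i) k = if j = k then 1 else 0 := by
  have h : ∀ i j, U (ge i) j = U.symm (ge j) i := by
    intro i j
    have := U.inner_map_map (U.symm (ge j)) (ge i)
    rw [U.apply_symm_apply, EuclideanSpace.inner_single_left, EuclideanSpace.inner_single_right] at this
    simpa using this
  have h2 := U.symm.inner_map_map (ge j) (ge k)
  rw [EuclideanSpace.inner_single_left, PiLp.inner_apply] at h2
  simp only [h]
  simp at h2
  rw [← h2]
  exact Finset.sum_congr rfl fun i _ => mul_comm _ _

theorem stmt5 {n : ℕ} (hn : 3 ≤ n) (ρ : Matrix (Fin n) (Fin n) ℂ → ℝ)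
    (h1 : ∀ A : Matrix (Fin n) (Fin n) ℂ, A.PosSemidef → 0 ≤ ρ A)
    (h2 : ∀ (c : ℝ) (A : Matrix (Fin n) (Fin n) ℂ), 0 ≤ c → A.PosSemidef →
      ρ ((c : ℂ) • A) = c * ρ A)
    (h3 : ∀ A B : Matrix (Fin n) (Fin n) ℂ, A.PosSemidef → B.PosSemidef → A * B = 0 →
      ρ (A + B) = ρ A + ρ B)
    (h4 : ContinuousOn ρ {A : Matrix (Fin n) (Fin n) ℂ | A.PosSemidef}) :
    (∃ H : Matrix (Fin n) (Fin n) ℂ, H.PosSemidef ∧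
      ∀ A : Matrix (Fin n) (Fin n) ℂ, A.PosSemidef → ρ A = ((H * A).trace).re) ∧
    (∀ A B : Matrix (Fin n) (Fin n) ℂ, A.PosSemidef → B.PosSemidef →
      ρ (A + B) = ρ A + ρ B) := by
  have hmain : ∃ H : Matrix (Fin n) (Fin n) ℂ, H.PosSemidef ∧
      ∀ A : Matrix (Fin n) (Fin n) ℂ, A.PosSemidef → ρ A = ((H * A).trace).re := by
    obtain ⟨l, -, hl⟩ := exists_list (E := EuclideanSpace ℂ (Fin n)) (by simpa using hn)
      (fun x => ρ (rk1 x)) (h4.comp_continuous rk1_cont rk1_psd) (fun x => h1 _ (rk1_psd x))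
      (by intro c x
          simp only [rk1_smul]
          exact h2 _ _ (by positivity) (rk1_psd x))
      (by intro u hu
          refine ⟨ρ (∑ j, rk1 (u j)), fun U => ?_⟩
          rw [← ortho_sum ρ h2 h3 Finset.univ (fun i => rk1 (∑ j, ((U (ge i) j : ℝ) : ℂ) • u j))
            (fun i => rk1_psd _)]
          · congr 1
            have ho := iso_ortho U
            have hexp : ∀ i, rk1 (∑ j, ((U (ge i) j : ℝ) : ℂ) • u j) =
                ∑ j, ∑ k, ((U (ge i) j * U (ge i) k : ℝ) : ℂ) •
                  vecMulVec (u j).ofLp (star (u k).ofLp) := by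
              intro i
              ext a b
              simp only [rk1, vecMulVec_apply, Matrix.sum_apply, Matrix.smul_apply, smul_eq_mul,
                Pi.star_apply, WithLp.ofLp_sum, Finset.sum_apply, WithLp.ofLp_smul, Pi.smul_apply,
                star_sum, star_mul, Finset.sum_mul_sum]
              refine Finset.sum_congr rfl fun j _ => Finset.sum_congr rfl fun k _ => ?_
              simp; ring
            simp only [hexp]
            rw [Finset.sum_comm]
            refine Finset.sum_congr rfl fun j _ => ?_
            rw [Finset.sum_comm]
            simp only [← Finset.sum_smul, ← Complex.ofReal_sum, ho]
            simp [rk1]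
          · intro i i' hii
            rw [rk1_mul]
            have : inner ℂ (∑ j, ((U (ge i) j : ℝ) : ℂ) • u j)
                (∑ j, ((U (ge i') j : ℝ) : ℂ) • u j) = 0 := by
              rw [hu.inner_sum]
              have := U.inner_map_map (ge i) (ge i')
              rw [EuclideanSpace.inner_single_left, PiLp.inner_apply] at this
              simp [hii] at this
              simp only [Complex.conj_ofReal]
              rw [← Complex.ofReal_zero, ← this]
              push_cast
              exact Finset.sum_congr rfl fun j _ => mul_comm _ _
            rw [this, zero_smul])
      _ ⊤ rfl
    refine ⟨(l.map rk1).sum, ?_, ?_⟩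
    · clear hl
      induction l with
      | nil => simpa using Matrix.PosSemidef.zero
      | cons a l ih => simpa using (rk1_psd a).add ih
    · intro A hA
      have hF : ∀ x, ρ (rk1 x) = (((l.map rk1).sum * rk1 x).trace).re := by
        intro x
        have := hl x trivial
        rw [this]
        clear this hl
        induction l with
        | nil => simp
        | cons a l ih =>
          simp only [List.map_cons, List.sum_cons, add_mul, trace_add, Complex.add_re, rk1_trace]
          rw [ih]
      generalize (l.map rk1).sum = H at hF
      let b := hA.1.eigenvectorBasis
      have hAd : A = ∑ i, ((hA.1.eigenvalues i : ℝ) : ℂ) • rk1 (b i) := by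
        have hs := hA.1.spectral_theorem
        conv_lhs => rw [hs]
        ext p q
        simp [Unitary.conjStarAlgAut_apply, Matrix.mul_apply, Matrix.sum_apply, diagonal_apply,
          Matrix.star_apply, rk1, vecMulVec_apply, b]
        refine Finset.sum_congr rfl fun i _ => ?_
        ring
      have hev : ∀ i, 0 ≤ hA.1.eigenvalues i := hA.eigenvalues_nonneg
      have hρ : ρ A = ∑ i, hA.1.eigenvalues i * ρ (rk1 (b i)) := by
        conv_lhs => rw [hAd]
        rw [ortho_sum ρ h2 h3]
        · exact Finset.sum_congr rfl fun i _ => h2 _ _ (hev i) (rk1_psd _)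
        · intro i
          exact (rk1_psd _).smul (by exact_mod_cast hev i)
        · intro i j hij
          rw [smul_mul_smul_comm, rk1_mul, b.orthonormal.2 hij, zero_smul, smul_zero]
      rw [hρ]
      conv_rhs => rw [hAd]
      rw [Finset.mul_sum, trace_sum, Complex.re_sum]
      refine Finset.sum_congr rfl fun i _ => ?_
      rw [hF, mul_smul_comm, trace_smul, smul_eq_mul, Complex.re_ofReal_mul]
  refine ⟨hmain, ?_⟩
  obtain ⟨H, -, hH⟩ := hmain
  intro A B hA hB
  rw [hH _ (hA.add hB), hH _ hA, hH _ hB, mul_add, trace_add, Complex.add_re]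
end

section
/- Let (X, 𝔄, μ) be a σ-finite measure space, let 1 ≤ p < ∞, and let ρ : L^p(μ; ℝ) → ℝ be a function such that for all f, g ∈ L^p(μ; ℝ) with f ≥ 0 and g ≥ 0 almost everywhere: (i) ρ(f) ≥ 0; (ii) ρ(c·f) = c·ρ(f) for every real c ≥ 0; (iii) ρ(f + g) = ρ(f) + ρ(g) whenever f·g = 0 almost everywhere; (iv) there is a constant C with ρ(f) ≤ C·‖f‖_p; and (v) if (f_n) is a sequence of almost-everywhere nonnegative elements with f_n → f in L^p, then ρ(f_n) → ρ(f). Then ρ(f + g) = ρ(f) + ρ(g) for all almost-everywhere nonnegative f, g ∈ L^p(μ; ℝ); consequently there is a continuous linear functional φ on L^p(μ; ℝ) with φ(f) = ρ(f) for every almost-everywhere nonnegative f. -/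
open MeasureTheory ENNReal Filter

theorem aux_smul {X : Type*} [MeasurableSpace X] {μ : Measure X}
    {p : ℝ≥0∞} {c : ℝ} {f : Lp ℝ p μ} (hc : 0 ≤ c) (hf : 0 ≤ f) : 0 ≤ c • f := by
  rw [← Lp.coeFn_nonneg] at hf ⊢
  filter_upwards [hf, Lp.coeFn_smul c f] with x e1 e2
  rw [e2]
  exact mul_nonneg hc e1

theorem aux_sum {X : Type*} [MeasurableSpace X] (μ : Measure X)
    (p : ℝ≥0∞) [Fact (1 ≤ p)] (ρ : Lp ℝ p μ → ℝ)
    (h2 : ∀ (c : ℝ) (f : Lp ℝ p μ), 0 ≤ c → 0 ≤ f → ρ (c • f) = c * ρ f)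
    (h3 : ∀ f g : Lp ℝ p μ, 0 ≤ f → 0 ≤ g →
      (∀ᵐ x ∂μ, f x * g x = 0) → ρ (f + g) = ρ f + ρ g)
    (E : ℕ → Lp ℝ p μ) (hE : ∀ k, 0 ≤ E k)
    (hd : ∀ i j, i ≠ j → ∀ᵐ x ∂μ, E i x * E j x = 0)
    (s : Finset ℕ) (c : ℕ → ℝ) (hc : ∀ k ∈ s, 0 ≤ c k) :
    ρ (∑ k ∈ s, c k • E k) = ∑ k ∈ s, c k * ρ (E k) := by
  induction s using Finset.induction_on with
  | empty =>
    have := h2 0 0 le_rfl le_rfl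
    simpa using this
  | insert a s ha ih =>
    rw [Finset.sum_insert ha, Finset.sum_insert ha, h3, h2, ih]
    · intro k hk; exact hc k (Finset.mem_insert_of_mem hk)
    · exact hc a (Finset.mem_insert_self _ _)
    · exact hE a
    · exact aux_smul (hc a (Finset.mem_insert_self _ _)) (hE a)
    · exact Finset.sum_nonneg fun k hk =>
        aux_smul (hc k (Finset.mem_insert_of_mem hk)) (hE k)
    · clear ih hc
      induction s using Finset.induction_on with
      | empty =>
        filter_upwards [Lp.coeFn_zero ℝ p μ] with x hx
        rw [Finset.sum_empty, hx]; simp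
      | insert b s hb ih =>
        rw [Finset.sum_insert hb]
        have hab : a ≠ b := by rintro rfl; simp at ha
        have has : a ∉ s := fun h => ha (Finset.mem_insert_of_mem h)
        filter_upwards [ih has, hd a b hab, Lp.coeFn_add (c b • E b) (∑ k ∈ s, c k • E k),
          Lp.coeFn_smul (c a) (E a), Lp.coeFn_smul (c b) (E b)] with x e1 e2 e3 e4 e5
        rw [e3, Pi.add_apply, mul_add, e1, e4, e5]
        simp only [Pi.smul_apply, smul_eq_mul]
        linear_combination c a * c b * e2

theorem aux_coe_sum {X : Type*} [MeasurableSpace X] (μ : Measure X)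
    (p : ℝ≥0∞) [Fact (1 ≤ p)] (E : ℕ → Lp ℝ p μ) (s : Finset ℕ) (c : ℕ → ℝ) :
    ∀ᵐ x ∂μ, (∑ k ∈ s, c k • E k : Lp ℝ p μ) x = ∑ k ∈ s, c k * E k x := by
  induction s using Finset.induction_on with
  | empty =>
    filter_upwards [Lp.coeFn_zero ℝ p μ] with x hx
    rw [Finset.sum_empty, hx]; simp
  | insert b s hb ih =>
    rw [Finset.sum_insert hb]
    filter_upwards [ih, Lp.coeFn_add (c b • E b) (∑ k ∈ s, c k • E k),
      Lp.coeFn_smul (c b) (E b)] with x e1 e2 e3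
    rw [Finset.sum_insert hb, e2, Pi.add_apply, e1, e3]
    simp

theorem aux_approx {X : Type*} [MeasurableSpace X] (μ : Measure X)
    (p : ℝ≥0∞) [Fact (1 ≤ p)] (ρ : Lp ℝ p μ → ℝ)
    (h2 : ∀ (c : ℝ) (f : Lp ℝ p μ), 0 ≤ c → 0 ≤ f → ρ (c • f) = c * ρ f)
    (h3 : ∀ f g : Lp ℝ p μ, 0 ≤ f → 0 ≤ g →
      (∀ᵐ x ∂μ, f x * g x = 0) → ρ (f + g) = ρ f + ρ g)
    (f g : Lp ℝ p μ) (hf : 0 ≤ f) (hg : 0 ≤ g) (n : ℕ) :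
    ∃ F G : Lp ℝ p μ, 0 ≤ F ∧ 0 ≤ G ∧ F + G = f + g ∧ ρ (f + g) = ρ F + ρ G ∧
      ‖f - F‖ ≤ 1 / ((n : ℝ) + 1) * ‖f + g‖ := by
  set h : Lp ℝ p μ := f + g with hh
  have hN : (0 : ℝ) < (n : ℝ) + 1 := by positivity
  let v : X → ℕ := fun x => ⌊((n : ℝ) + 1) * (f x / (f x + g x))⌋₊
  have hv : Measurable v := by
    have hfm := (Lp.stronglyMeasurable f).measurable
    have hgm := (Lp.stronglyMeasurable g).measurable
    exact Nat.measurable_floor.comp ((hfm.div (hfm.add hgm)).const_mul _)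
  have hA : ∀ k, MeasurableSet (v ⁻¹' {k}) := fun k => hv (measurableSet_singleton k)
  let E : ℕ → Lp ℝ p μ := fun k => ((Lp.memLp h).indicator (hA k)).toLp _
  have hEc : ∀ k, E k =ᵐ[μ] (v ⁻¹' {k}).indicator h := fun k => MemLp.coeFn_toLp _
  have hh0 : 0 ≤ h := add_nonneg hf hg
  have hf' := (Lp.coeFn_nonneg f).2 hf
  have hg' := (Lp.coeFn_nonneg g).2 hg
  have hh' := (Lp.coeFn_nonneg h).2 hh0
  have hE : ∀ k, 0 ≤ E k := by
    intro k
    rw [← Lp.coeFn_nonneg]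
    filter_upwards [hEc k, hh'] with x e1 e2
    rw [e1]
    exact Set.indicator_apply_nonneg fun _ => e2
  have hd : ∀ i j, i ≠ j → ∀ᵐ x ∂μ, E i x * E j x = 0 := by
    intro i j hij
    filter_upwards [hEc i, hEc j] with x e1 e2
    rw [e1, e2]
    by_cases hx : v x = i
    · have : v x ≠ j := by rw [hx]; exact hij
      simp [Set.indicator, this]
    · simp [Set.indicator, hx]
  have hvle : ∀ᵐ x ∂μ, v x ∈ Finset.range (n + 2) := by
    filter_upwards [hf', hg'] with x e1 e2
    simp only [Pi.zero_apply] at e1 e2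
    have : f x / (f x + g x) ≤ 1 := div_le_one_of_le₀ (by linarith) (by positivity)
    rw [Finset.mem_range, Nat.lt_succ_iff]
    apply Nat.floor_le_of_le
    push_cast
    nlinarith
  have key : ∀ c : ℕ → ℝ, ∀ᵐ x ∂μ,
      (∑ k ∈ Finset.range (n + 2), c k • E k : Lp ℝ p μ) x = c (v x) * h x := by
    intro c
    filter_upwards [aux_coe_sum μ p E (Finset.range (n + 2)) c, hvle, ae_all_iff.2 hEc]
      with x e1 e2 e3
    rw [e1, Finset.sum_eq_single_of_mem (v x) e2]
    · rw [e3]; simp [Set.indicator]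
    · intro b _ hb
      rw [e3]; simp [Set.indicator, hb.symm]
  have hsum : ∑ k ∈ Finset.range (n + 2), (1 : ℝ) • E k = h := by
    apply Lp.ext
    filter_upwards [key fun _ => 1] with x e
    rw [e, one_mul]
  have c1 : ∀ k ∈ Finset.range (n + 2), 0 ≤ (k : ℝ) / ((n : ℝ) + 1) := fun k _ => by positivity
  have c2 : ∀ k ∈ Finset.range (n + 2), 0 ≤ 1 - (k : ℝ) / ((n : ℝ) + 1) := fun k hk => by
    rw [sub_nonneg, div_le_one hN]
    have := Nat.lt_succ_iff.1 (Finset.mem_range.1 hk)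
    exact_mod_cast this
  refine ⟨∑ k ∈ Finset.range (n + 2), ((k : ℝ) / ((n : ℝ) + 1)) • E k,
    ∑ k ∈ Finset.range (n + 2), (1 - (k : ℝ) / ((n : ℝ) + 1)) • E k,
    Finset.sum_nonneg fun k hk => aux_smul (c1 k hk) (hE k),
    Finset.sum_nonneg fun k hk => aux_smul (c2 k hk) (hE k), ?_, ?_, ?_⟩
  · rw [← Finset.sum_add_distrib, ← hsum]
    refine Finset.sum_congr rfl fun k _ => ?_
    rw [← add_smul]; congr 1; ring
  · rw [aux_sum μ p ρ h2 h3 E hE hd _ (fun k : ℕ => (k : ℝ) / ((n : ℝ) + 1)) c1,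
      aux_sum μ p ρ h2 h3 E hE hd _ (fun k : ℕ => 1 - (k : ℝ) / ((n : ℝ) + 1)) c2]
    conv_lhs => rw [← hsum, aux_sum μ p ρ h2 h3 E hE hd _ (fun _ => 1) (fun _ _ => zero_le_one)]
    rw [← Finset.sum_add_distrib]
    exact Finset.sum_congr rfl fun k _ => by ring
  · apply Lp.norm_le_mul_norm_of_ae_le_mul
    filter_upwards [key fun k => (k : ℝ) / ((n : ℝ) + 1), hf', hg', Lp.coeFn_add f g,
      Lp.coeFn_sub f (∑ k ∈ Finset.range (n + 2), ((k : ℝ) / ((n : ℝ) + 1)) • E k)]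
      with x e1 e2 e3 e4 e5
    rw [e5, Pi.sub_apply, e1, hh, e4, Pi.add_apply]
    simp only [Pi.zero_apply] at e2 e3
    have hs : 0 ≤ f x + g x := add_nonneg e2 e3
    have hu : f x = f x / (f x + g x) * (f x + g x) := by
      rcases hs.eq_or_lt with h0 | h0
      · rw [← h0]; simp; linarith
      · field_simp
    have hu0 : 0 ≤ f x / (f x + g x) := by positivity
    have l1 : (v x : ℝ) ≤ ((n : ℝ) + 1) * (f x / (f x + g x)) := Nat.floor_le (by positivity)
    have l2 : ((n : ℝ) + 1) * (f x / (f x + g x)) < v x + 1 := Nat.lt_floor_add_one _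
    rw [Real.norm_of_nonneg hs]
    generalize f x / (f x + g x) = u at *
    have : f x - (v x : ℝ) / ((n : ℝ) + 1) * (f x + g x)
        = (u - (v x : ℝ) / ((n : ℝ) + 1)) * (f x + g x) := by
      linear_combination hu
    rw [this, norm_mul, Real.norm_of_nonneg hs]
    refine mul_le_mul_of_nonneg_right ?_ hs
    have : u - (v x : ℝ) / ((n : ℝ) + 1) = (((n : ℝ) + 1) * u - v x) / ((n : ℝ) + 1) := by
      field_simp
    rw [this, Real.norm_of_nonneg (div_nonneg (by linarith) hN.le)]
    exact div_le_div_of_nonneg_right (by linarith) hN.le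

theorem aux_ext {X : Type*} [MeasurableSpace X] (μ : Measure X)
    (p : ℝ≥0∞) [Fact (1 ≤ p)] (ρ : Lp ℝ p μ → ℝ)
    (h1 : ∀ f : Lp ℝ p μ, 0 ≤ f → 0 ≤ ρ f)
    (h2 : ∀ (c : ℝ) (f : Lp ℝ p μ), 0 ≤ c → 0 ≤ f → ρ (c • f) = c * ρ f)
    (h4 : ∃ C : ℝ, ∀ f : Lp ℝ p μ, 0 ≤ f → ρ f ≤ C * ‖f‖)
    (ha : ∀ f g : Lp ℝ p μ, 0 ≤ f → 0 ≤ g → ρ (f + g) = ρ f + ρ g) :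
    ∃ φ : Lp ℝ p μ →L[ℝ] ℝ, ∀ f : Lp ℝ p μ, 0 ≤ f → φ f = ρ f := by
  obtain ⟨C, hC⟩ := h4
  have hpn : ∀ f : Lp ℝ p μ, f⁺ - f⁻ = f := posPart_sub_negPart
  have hwd : ∀ f a b : Lp ℝ p μ, 0 ≤ a → 0 ≤ b → f = a - b → ρ f⁺ - ρ f⁻ = ρ a - ρ b := by
    intro f a b h0 h0' hab
    have e : f⁺ + b = a + f⁻ := by
      have := hpn f
      rw [sub_eq_iff_eq_add] at this
      rw [this]
      nth_rewrite 1 [hab]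
      abel
    have := congrArg ρ e
    rw [ha _ _ (posPart_nonneg f) h0', ha _ _ h0 (negPart_nonneg f)] at this
    linarith
  let L : Lp ℝ p μ →ₗ[ℝ] ℝ :=
    { toFun := fun f => ρ f⁺ - ρ f⁻
      map_add' := fun f g => by
        rw [hwd (f + g) (f⁺ + g⁺) (f⁻ + g⁻) (add_nonneg (posPart_nonneg f) (posPart_nonneg g))
          (add_nonneg (negPart_nonneg f) (negPart_nonneg g)),
          ha _ _ (posPart_nonneg f) (posPart_nonneg g),
          ha _ _ (negPart_nonneg f) (negPart_nonneg g)]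
        · ring
        · nth_rewrite 1 [← hpn f, ← hpn g]
          abel
      map_smul' := fun c f => by
        have p0 := posPart_nonneg f
        have n0 := negPart_nonneg f
        simp only [RingHom.id_apply, smul_eq_mul]
        rcases le_total 0 c with hc | hc
        · rw [hwd (c • f) (c • f⁺) (c • f⁻) (aux_smul hc p0) (aux_smul hc n0),
            h2 _ _ hc p0, h2 _ _ hc n0]
          · ring
          · rw [← smul_sub, hpn]
        · have hc' : 0 ≤ -c := by linarith
          rw [hwd (c • f) ((-c) • f⁻) ((-c) • f⁺) (aux_smul hc' n0) (aux_smul hc' p0),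
            h2 _ _ hc' p0, h2 _ _ hc' n0]
          · ring
          · rw [← smul_sub, neg_smul, ← smul_neg, neg_sub, hpn] }
  refine ⟨L.mkContinuous |C| fun f => ?_, fun f hf => ?_⟩
  · have b : ∀ a : Lp ℝ p μ, 0 ≤ a → ‖a‖ ≤ ‖f‖ → ρ a ≤ |C| * ‖f‖ := fun a h0 h => by
      refine (hC a h0).trans ?_
      exact mul_le_mul (le_abs_self C) h (norm_nonneg _) (abs_nonneg _)
    have q1 : ‖f⁺‖ ≤ ‖f‖ := norm_le_norm_of_abs_le_abs (by
      rw [abs_of_nonneg (posPart_nonneg f)]; exact sup_le (le_abs_self f) (abs_nonneg f))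
    have q2 : ‖f⁻‖ ≤ ‖f‖ := norm_le_norm_of_abs_le_abs (by
      rw [abs_of_nonneg (negPart_nonneg f)]; exact sup_le (neg_le_abs f) (abs_nonneg f))
    change |ρ f⁺ - ρ f⁻| ≤ _
    rw [abs_le]
    constructor <;> linarith [b _ (posPart_nonneg f) q1, b _ (negPart_nonneg f) q2,
      h1 _ (posPart_nonneg f), h1 _ (negPart_nonneg f)]
  · have z : ρ 0 = 0 := by simpa using h2 0 0 le_rfl le_rfl
    change ρ f⁺ - ρ f⁻ = ρ f
    rw [hwd f f 0 hf le_rfl (by simp), z, sub_zero]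

/-- The extension property EPp in the commutative (σ-finite) case: every continuous
finite measure on the positive cone of `L^p(μ; ℝ)` is additive, hence given by a
continuous linear functional. -/
theorem stmt6 {X : Type*} [MeasurableSpace X] (μ : Measure X) [SigmaFinite μ]
    (p : ℝ≥0∞) [Fact (1 ≤ p)] (hptop : p ≠ ∞)
    (ρ : Lp ℝ p μ → ℝ)
    (h1 : ∀ f : Lp ℝ p μ, (∀ᵐ x ∂μ, 0 ≤ f x) → 0 ≤ ρ f)
    (h2 : ∀ (c : ℝ) (f : Lp ℝ p μ), 0 ≤ c → (∀ᵐ x ∂μ, 0 ≤ f x) → ρ (c • f) = c * ρ f)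
    (h3 : ∀ f g : Lp ℝ p μ, (∀ᵐ x ∂μ, 0 ≤ f x) → (∀ᵐ x ∂μ, 0 ≤ g x) →
      (∀ᵐ x ∂μ, f x * g x = 0) → ρ (f + g) = ρ f + ρ g)
    (h4 : ∃ C : ℝ, ∀ f : Lp ℝ p μ, (∀ᵐ x ∂μ, 0 ≤ f x) → ρ f ≤ C * ‖f‖)
    (h5 : ∀ (fn : ℕ → Lp ℝ p μ) (f : Lp ℝ p μ),
      (∀ n, ∀ᵐ x ∂μ, 0 ≤ fn n x) → (∀ᵐ x ∂μ, 0 ≤ f x) →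
      Tendsto fn atTop (nhds f) → Tendsto (fun n => ρ (fn n)) atTop (nhds (ρ f))) :
    (∀ f g : Lp ℝ p μ, (∀ᵐ x ∂μ, 0 ≤ f x) → (∀ᵐ x ∂μ, 0 ≤ g x) →
      ρ (f + g) = ρ f + ρ g) ∧
    (∃ φ : Lp ℝ p μ →L[ℝ] ℝ, ∀ f : Lp ℝ p μ, (∀ᵐ x ∂μ, 0 ≤ f x) → φ f = ρ f) := by
  have ae0 : ∀ f : Lp ℝ p μ, (∀ᵐ x ∂μ, 0 ≤ f x) ↔ 0 ≤ f := fun f => Lp.coeFn_nonneg f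
  simp only [ae0] at *
  have hadd : ∀ f g : Lp ℝ p μ, 0 ≤ f → 0 ≤ g → ρ (f + g) = ρ f + ρ g := by
    intro f g hf hg
    choose F G hF hG hFG hρ hn using aux_approx μ p ρ h2 h3 f g hf hg
    have tF : Tendsto F atTop (nhds f) := by
      rw [tendsto_iff_norm_sub_tendsto_zero]
      refine squeeze_zero (g := fun n : ℕ => 1 / ((n : ℝ) + 1) * ‖f + g‖) (fun _ => norm_nonneg _)
        (fun n => by rw [norm_sub_rev]; exact hn n) ?_
      simpa using (tendsto_one_div_add_atTop_nhds_zero_nat (𝕜 := ℝ)).mul_const ‖f + g‖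
    have tG : Tendsto G atTop (nhds g) := by
      have hG' : G = fun n => (f + g) - F n := by
        funext n; rw [← hFG n]; abel
      rw [hG']
      simpa using tF.const_sub (f + g)
    have t := (h5 F f hF hf tF).add (h5 G g hG hg tG)
    simp only [← hρ] at t
    exact tendsto_nhds_unique tendsto_const_nhds t
  exact ⟨hadd, aux_ext μ p ρ h1 h2 h4 hadd⟩
end

section
/- There exist a function ρ : M₂(ℂ) → ℝ and a constant C ≥ 0 such that: (i) ρ(A) ≥ 0 for every PSD matrix A; (ii) ρ(c·A) = c·ρ(A) for every real c ≥ 0 and PSD A; (iii) ρ(A + B) = ρ(A) + ρ(B) whenever A and B are PSD with AB = 0; (iv) ρ(A) ≤ C·‖A‖ for every PSD A; (v) ρ is continuous on the set of PSD matrices; and yet (vi) there are PSD matrices A, B ∈ M₂(ℂ) with ρ(A + B) ≠ ρ(A) + ρ(B). -/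
open Matrix
open scoped ComplexOrder

attribute [local instance] Matrix.normedAddCommGroup

/-- The median of `a`, `b` and `0`. -/
noncomputable def medz (a b : ℝ) : ℝ := max (min a b) (min (max a b) 0)

theorem medz_neg (a b : ℝ) : medz (-a) (-b) = - medz a b := by
  unfold medz
  simp only [max_def, min_def]
  split_ifs <;> linarith

theorem medz_mul_nonneg (k a b : ℝ) (hk : 0 ≤ k) : medz (k * a) (k * b) = k * medz a b := by
  unfold medz
  rw [mul_max_of_nonneg _ _ hk, mul_min_of_nonneg _ _ hk, mul_min_of_nonneg _ _ hk,
    mul_max_of_nonneg _ _ hk, mul_zero]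

theorem medz_mul (k a b : ℝ) : medz (k * a) (k * b) = k * medz a b := by
  rcases le_total 0 k with hk | hk
  · exact medz_mul_nonneg k a b hk
  · have h := medz_mul_nonneg (-k) a b (by linarith)
    have h2 := medz_neg (k * a) (k * b)
    rw [← neg_mul, ← neg_mul, h] at h2
    linarith

theorem medz_abs_le (a b : ℝ) : |medz a b| ≤ |a| := by
  unfold medz
  simp only [max_def, min_def, abs_eq_max_neg]
  split_ifs <;> linarith

theorem medz_add (a b c d : ℝ) (h : a * d = c * b) :
    medz (a + c) (b + d) = medz a b + medz c d := by
  have key : ∀ k, c = k * a → d = k * b → medz (a + c) (b + d) = medz a b + medz c d := by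
    rintro k rfl rfl
    have := medz_mul (1 + k) a b
    rw [medz_mul, show a + k * a = (1 + k) * a by ring, show b + k * b = (1 + k) * b by ring,
      this]
    ring
  by_cases ha : a = 0
  · by_cases hb : b = 0
    · subst ha hb
      simp [medz]
    · have hc : c = 0 := by
        subst ha
        simpa [hb] using h.symm
      refine key (d / b) (by rw [hc, ha, mul_zero]) (by field_simp)
  · refine key (c / a) (by field_simp) (by field_simp; linarith)

theorem diag_re_nonneg (A : Matrix (Fin 2) (Fin 2) ℂ) (hA : A.PosSemidef) (i : Fin 2) :
    0 ≤ (A i i).re := (Complex.le_def.1 (hA.diag_nonneg (i := i))).1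

/-- The algebra `M₂(ℂ)` fails the extension property: there is a continuous finite
measure on the PSD cone of `M₂(ℂ)` (nonnegative, positively homogeneous, additive on
orthogonal pairs, bounded and continuous) which is not additive. -/
theorem stmt7 :
    ∃ (ρ : Matrix (Fin 2) (Fin 2) ℂ → ℝ) (C : ℝ), 0 ≤ C ∧
      (∀ A : Matrix (Fin 2) (Fin 2) ℂ, A.PosSemidef → 0 ≤ ρ A) ∧
      (∀ (c : ℝ) (A : Matrix (Fin 2) (Fin 2) ℂ), 0 ≤ c → A.PosSemidef →
        ρ ((c : ℂ) • A) = c * ρ A) ∧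
      (∀ A B : Matrix (Fin 2) (Fin 2) ℂ, A.PosSemidef → B.PosSemidef → A * B = 0 →
        ρ (A + B) = ρ A + ρ B) ∧
      (∀ A : Matrix (Fin 2) (Fin 2) ℂ, A.PosSemidef → ρ A ≤ C * ‖A‖) ∧
      ContinuousOn ρ {A : Matrix (Fin 2) (Fin 2) ℂ | A.PosSemidef} ∧
      (∃ A B : Matrix (Fin 2) (Fin 2) ℂ, A.PosSemidef ∧ B.PosSemidef ∧
        ρ (A + B) ≠ ρ A + ρ B) := by
  refine ⟨fun A => ((A 0 0).re + (A 1 1).re) + medz ((A 0 0).re - (A 1 1).re) (A 0 1).re, 4,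
    by norm_num, ?_, ?_, ?_, ?_, ?_, ?_⟩
  · intro A hA
    have h0 := diag_re_nonneg A hA 0
    have h1 := diag_re_nonneg A hA 1
    have h := medz_abs_le ((A 0 0).re - (A 1 1).re) (A 0 1).re
    have h2 : |(A 0 0).re - (A 1 1).re| ≤ (A 0 0).re + (A 1 1).re := by
      rw [abs_le]; constructor <;> linarith
    have h3 := (abs_le.1 (h.trans h2)).1
    simp only
    linarith
  · intro c A hc hA
    simp only [Matrix.smul_apply, smul_eq_mul, Complex.re_ofReal_mul]
    rw [← mul_sub, medz_mul]
    ring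
  · intro A B hA hB hAB
    have hBA : B * A = 0 := by
      have := congrArg Matrix.conjTranspose hAB
      rwa [Matrix.conjTranspose_mul, hA.isHermitian.eq, hB.isHermitian.eq,
        Matrix.conjTranspose_zero] at this
    have e1 := congrFun (congrFun hAB 0) 1
    have e2 := congrFun (congrFun hBA 0) 1
    have im : ∀ M : Matrix (Fin 2) (Fin 2) ℂ, M.PosSemidef → ∀ i, (M i i).im = 0 := fun M hM i =>
      (Complex.le_def.1 (hM.diag_nonneg (i := i))).2.symm
    simp only [Matrix.mul_apply, Fin.sum_univ_two, Matrix.zero_apply] at e1 e2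
    have f1 := congrArg Complex.re e1
    have f2 := congrArg Complex.re e2
    simp only [Complex.add_re, Complex.mul_re, im A hA, im B hB, Complex.zero_re, zero_mul,
      mul_zero, sub_zero] at f1 f2
    have := medz_add ((A 0 0).re - (A 1 1).re) (A 0 1).re ((B 0 0).re - (B 1 1).re) (B 0 1).re
      (by linarith)
    simp only [Matrix.add_apply, Complex.add_re]
    rw [show (A 0 0).re + (B 0 0).re - ((A 1 1).re + (B 1 1).re)
      = (A 0 0).re - (A 1 1).re + ((B 0 0).re - (B 1 1).re) by ring, this]
    ring
  · intro A hA
    have h0 := diag_re_nonneg A hA 0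
    have h1 := diag_re_nonneg A hA 1
    have h := medz_abs_le ((A 0 0).re - (A 1 1).re) (A 0 1).re
    have h2 : |(A 0 0).re - (A 1 1).re| ≤ (A 0 0).re + (A 1 1).re := by
      rw [abs_le]; constructor <;> linarith
    have h3 := (abs_le.1 (h.trans h2)).2
    have n0 : (A 0 0).re ≤ ‖A‖ := (Complex.re_le_norm _).trans (Matrix.norm_entry_le_entrywise_sup_norm A)
    have n1 : (A 1 1).re ≤ ‖A‖ := (Complex.re_le_norm _).trans (Matrix.norm_entry_le_entrywise_sup_norm A)
    simp only
    linarith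
  · apply Continuous.continuousOn
    unfold medz
    have c : ∀ i j, Continuous fun A : Matrix (Fin 2) (Fin 2) ℂ => (A i j).re := fun i j =>
      Complex.continuous_re.comp (continuous_id.matrix_elem i j)
    have c0 := c 0 0
    have c1 := c 1 1
    have c2 := c 0 1
    fun_prop
  · refine ⟨!![1, 0; 0, 0]ᴴ * !![1, 0; 0, 0] + !![1, 0; 0, 0]ᴴ * !![1, 0; 0, 0],
      !![1, 1; 0, 0]ᴴ * !![1, 1; 0, 0],
      (Matrix.posSemidef_conjTranspose_mul_self _).add (Matrix.posSemidef_conjTranspose_mul_self _),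
      Matrix.posSemidef_conjTranspose_mul_self _, ?_⟩
    simp [Matrix.mul_apply, Fin.sum_univ_two, medz]
    try norm_num
end

section
/- Let c ≥ 0 and let f be a continuous function, with f(p) ≥ 0, defined on the set of rank-one projections in M₂(ℂ) (matrices p with pᴴ = p, p² = p, tr(p) = 1), satisfying f(p) + f(1 − p) = c for every such p. Then there exists a function ρ : M₂(ℂ) → ℝ such that: (i) ρ(A) ≥ 0 for every PSD matrix A; (ii) ρ(c'·A) = c'·ρ(A) for every real c' ≥ 0 and PSD A; (iii) ρ(A + B) = ρ(A) + ρ(B) whenever A and B are PSD with AB = 0; (iv) ρ is continuous on the set of PSD matrices; and (v) ρ(p) = f(p) for every rank-one projection p, and ρ(1) = c. -/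
open Matrix
open scoped ComplexOrder

namespace Stmt8Aux

abbrev M := Matrix (Fin 2) (Fin 2) ℂ

def IsP (p : M) : Prop := pᴴ = p ∧ p * p = p ∧ p.trace = 1

def H (α β x y : ℝ) : M := !![(α : ℂ), ⟨x, y⟩; ⟨x, -y⟩, (β : ℂ)]

lemma exists_H {A : M} (h : Aᴴ = A) : ∃ α β x y, A = H α β x y := by
  refine ⟨(A 0 0).re, (A 1 1).re, (A 0 1).re, (A 0 1).im, ?_⟩
  have h00 := congrFun (congrFun h 0) 0
  have h10 := congrFun (congrFun h 1) 0
  have h11 := congrFun (congrFun h 1) 1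
  simp only [conjTranspose_apply, Complex.ext_iff, RCLike.star_def, Complex.conj_re,
    Complex.conj_im] at h00 h10 h11
  ext i j
  fin_cases i <;> fin_cases j <;> apply Complex.ext <;> simp [H] <;> linarith [h00.2, h10.1, h10.2, h11.2]

lemma isP_H (α β x y : ℝ) :
    IsP (H α β x y) ↔ α + β = 1 ∧ (α - β) ^ 2 + 4 * (x ^ 2 + y ^ 2) = 1 := by
  constructor
  · rintro ⟨-, h2, h3⟩
    have h00 := congrFun (congrFun h2 0) 0
    simp [H, Matrix.mul_apply, Matrix.trace, Complex.ext_iff] at h00 h3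
    refine ⟨h3, ?_⟩
    have : β = 1 - α := by linarith
    subst this
    nlinarith [h00.1]
  · rintro ⟨h1, h2⟩
    have : β = 1 - α := by linarith
    subst this
    refine ⟨?_, ?_, ?_⟩
    · ext i j
      fin_cases i <;> fin_cases j <;> apply Complex.ext <;> simp [H]
    · ext i j
      fin_cases i <;> fin_cases j <;> apply Complex.ext <;> simp [H, Matrix.mul_apply] <;> nlinarith
    · simp [H, Matrix.trace]

lemma IsP.compl {p : M} (h : IsP p) : IsP (1 - p) := by
  obtain ⟨h1, h2, h3⟩ := h
  refine ⟨by simp [h1], ?_, ?_⟩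
  · simp [sub_mul, mul_sub, h2]
  · rw [Matrix.trace_sub, h3]; simp; norm_num

noncomputable def s (A : M) : ℝ :=
  √(((A 0 0).re - (A 1 1).re) ^ 2 + 4 * ((A 0 1).re ^ 2 + (A 0 1).im ^ 2))

noncomputable def l (A : M) : ℝ := ((A 0 0).re + (A 1 1).re - s A) / 2

noncomputable def P (A : M) : M := (((s A)⁻¹ : ℝ) : ℂ) • (A - ((l A : ℝ) : ℂ) • (1 : M))

noncomputable def rho (c : ℝ) (f : M → ℝ) (A : M) : ℝ := l A * c + s A * f (P A)

lemma s_nonneg (A : M) : 0 ≤ s A := Real.sqrt_nonneg _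

lemma continuous_s : Continuous s := by unfold s; fun_prop

lemma continuous_l : Continuous l := by
  have := continuous_s
  unfold l; fun_prop

lemma isP_P {A : M} (h : Aᴴ = A) (hs : s A ≠ 0) : IsP (P A) := by
  obtain ⟨α, β, x, y, rfl⟩ := exists_H h
  have h2 : s (H α β x y) ^ 2 = (α - β) ^ 2 + 4 * (x ^ 2 + y ^ 2) := by
    unfold s
    rw [Real.sq_sqrt (by positivity)]
    simp [H]
  have hl : l (H α β x y) = (α + β - s (H α β x y)) / 2 := by simp [l, H]
  unfold P
  set σ := s (H α β x y)
  set L := l (H α β x y)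
  have : ((σ⁻¹ : ℝ) : ℂ) • (H α β x y - ((L : ℝ) : ℂ) • (1 : M)) =
      H (σ⁻¹ * (α - L)) (σ⁻¹ * (β - L)) (σ⁻¹ * x) (σ⁻¹ * y) := by
    ext i j
    fin_cases i <;> fin_cases j <;> apply Complex.ext <;> simp [H, -Complex.ofReal_inv]
  rw [this, isP_H, hl]
  constructor
  · field_simp; ring
  · field_simp; linarith

lemma decomp {A : M} (h : Aᴴ = A) : ∃ (a b : ℝ) (p : M), IsP p ∧
    A = (a : ℂ) • p + (b : ℂ) • (1 - p) := by
  by_cases hs : s A = 0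
  · obtain ⟨α, β, x, y, rfl⟩ := exists_H h
    have h2 : s (H α β x y) ^ 2 = (α - β) ^ 2 + 4 * (x ^ 2 + y ^ 2) := by
      unfold s
      rw [Real.sq_sqrt (by positivity)]
      simp [H]
    rw [hs] at h2
    have hx : x = 0 := by nlinarith [sq_nonneg (α - β), sq_nonneg x, sq_nonneg y]
    have hy : y = 0 := by nlinarith [sq_nonneg (α - β), sq_nonneg x, sq_nonneg y]
    have hb : α = β := by nlinarith [sq_nonneg (α - β), sq_nonneg x, sq_nonneg y]
    subst hx hy hb
    refine ⟨α, α, H 1 0 0 0, (isP_H _ _ _ _).2 (by norm_num), ?_⟩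
    rw [← smul_add]
    ext i j
    fin_cases i <;> fin_cases j <;> apply Complex.ext <;> simp [H]
  · refine ⟨l A + s A, l A, P A, isP_P h hs, ?_⟩
    have : ((s A : ℝ) : ℂ) • P A = A - ((l A : ℝ) : ℂ) • (1 : M) := by
      unfold P
      rw [smul_smul, ← Complex.ofReal_mul, mul_inv_cancel₀ hs]; simp
    push_cast
    rw [add_smul, this, smul_sub]
    abel

lemma s_comb {p : M} (hp : IsP p) (a b : ℝ) :
    s ((a : ℂ) • p + (b : ℂ) • (1 - p)) = |a - b| := by
  obtain ⟨α, β, x, y, rfl⟩ := exists_H hp.1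
  rw [isP_H] at hp
  obtain ⟨h1, h2⟩ := hp
  rw [← Real.sqrt_sq_eq_abs]
  unfold s
  congr 1
  simp [H]
  linear_combination (a-b)^2 * h2

lemma l_comb {p : M} (hp : IsP p) (a b : ℝ) :
    l ((a : ℂ) • p + (b : ℂ) • (1 - p)) = (a + b - |a - b|) / 2 := by
  unfold l
  rw [s_comb hp]
  obtain ⟨α, β, x, y, rfl⟩ := exists_H hp.1
  rw [isP_H] at hp
  obtain ⟨h1, h2⟩ := hp
  simp [H]
  linear_combination (a-b) * h1

lemma rho_comb_lt {c : ℝ} {f : M → ℝ} (hf : ∀ p, IsP p → f p + f (1 - p) = c)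
    {p : M} (hp : IsP p) {a b : ℝ} (hab : b < a) :
    rho c f ((a : ℂ) • p + (b : ℂ) • (1 - p)) = a * f p + b * f (1 - p) := by
  have habs : |a - b| = a - b := abs_of_pos (by linarith)
  have hP : P ((a : ℂ) • p + (b : ℂ) • (1 - p)) = p := by
    unfold P
    rw [s_comb hp, l_comb hp, habs]
    have e : (a + b - (a - b)) / 2 = b := by ring
    rw [e]
    have : (a : ℂ) • p + (b : ℂ) • (1 - p) - (b : ℂ) • (1 : M) = ((a - b : ℝ) : ℂ) • p := by
      push_cast
      module
    rw [this, smul_smul, ← Complex.ofReal_mul, inv_mul_cancel₀ (by linarith)]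
    simp
  unfold rho
  rw [hP, s_comb hp, l_comb hp, habs, ← hf p hp]
  ring

lemma rho_comb {c : ℝ} {f : M → ℝ} (hf : ∀ p, IsP p → f p + f (1 - p) = c)
    {p : M} (hp : IsP p) (a b : ℝ) :
    rho c f ((a : ℂ) • p + (b : ℂ) • (1 - p)) = a * f p + b * f (1 - p) := by
  rcases lt_trichotomy b a with h | h | h
  · exact rho_comb_lt hf hp h
  · subst h
    unfold rho
    rw [s_comb hp, l_comb hp, ← hf p hp]
    simp
    ring
  · have := rho_comb_lt hf hp.compl h
    rw [sub_sub_cancel] at this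
    rw [add_comm, this, add_comm]

lemma corner {q : M} (hq : IsP q) (B : M) : q * B * q = (q * B).trace • q := by
  obtain ⟨α, β, x, y, rfl⟩ := exists_H hq.1
  rw [isP_H] at hq
  obtain ⟨h1, h2⟩ := hq
  have hd : (H α β x y) 0 0 * (H α β x y) 1 1 = (H α β x y) 0 1 * (H α β x y) 1 0 := by
    apply Complex.ext <;> simp [H] <;> nlinarith
  generalize H α β x y = q at hd
  ext i j
  fin_cases i <;> fin_cases j <;> simp [Matrix.mul_apply, Matrix.trace]
  · linear_combination (-B 1 1) * hd
  · linear_combination (B 0 1) * hd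
  · linear_combination (B 1 0) * hd
  · linear_combination (-B 0 0) * hd

lemma orth {p B : M} (hp : IsP p) (hB : Bᴴ = B) (h : p * B = 0) :
    ∃ β : ℝ, B = (β : ℂ) • (1 - p) := by
  have h' : B * p = 0 := by
    have := congrArg conjTranspose h
    rwa [conjTranspose_mul, hp.1, hB, conjTranspose_zero] at this
  have h1 : (1 - p) * B = B := by rw [sub_mul, h]; simp
  have h2 : B * (1 - p) = B := by rw [mul_sub, h']; simp
  have := corner hp.compl B
  rw [h1, h2] at this
  refine ⟨B.trace.re, ?_⟩
  have ht : ((B.trace.re : ℝ) : ℂ) = B.trace := by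
    rw [← Complex.conj_eq_iff_re]
    have := Matrix.trace_conjTranspose B
    rw [hB] at this
    exact this.symm
  rw [ht]; exact this

lemma add_aux {c : ℝ} {f : M → ℝ} (hf : ∀ p, IsP p → f p + f (1 - p) = c)
    {p B : M} (hp : IsP p) (hB : Bᴴ = B) {a b : ℝ} (ha : a ≠ 0)
    (h : ((a : ℂ) • p + (b : ℂ) • (1 - p)) * B = 0) :
    rho c f ((a : ℂ) • p + (b : ℂ) • (1 - p) + B) =
      rho c f ((a : ℂ) • p + (b : ℂ) • (1 - p)) + rho c f B := by
  have hpB : p * B = 0 := by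
    have h1 : p * (((a : ℂ) • p + (b : ℂ) • (1 - p)) * B) = (a : ℂ) • (p * B) := by
      rw [← mul_assoc, mul_add, mul_smul_comm, mul_smul_comm, mul_sub, hp.2.1]
      simp
    rw [h, mul_zero] at h1
    have := smul_eq_zero.1 h1.symm
    simpa [ha] using this
  obtain ⟨β, rfl⟩ := orth hp hB hpB
  have e1 : (a : ℂ) • p + (b : ℂ) • (1 - p) + (β : ℂ) • (1 - p) =
      (a : ℂ) • p + ((b + β : ℝ) : ℂ) • (1 - p) := by push_cast; module
  have e2 : (β : ℂ) • (1 - p) = ((0 : ℝ) : ℂ) • p + (β : ℂ) • (1 - p) := by simp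
  rw [e1, e2, rho_comb hf hp, rho_comb hf hp, rho_comb hf hp]
  ring

lemma rho_zero {c : ℝ} {f : M → ℝ} : rho c f 0 = 0 := by
  simp [rho, l, s]

lemma psd_coeff {p : M} (hp : IsP p) {a b : ℝ}
    (h : ((a : ℂ) • p + (b : ℂ) • (1 - p)).PosSemidef) : 0 ≤ a := by
  have h1 := (h.conjTranspose_mul_mul_same p).trace_nonneg
  have : pᴴ * ((a : ℂ) • p + (b : ℂ) • (1 - p)) * p = (a : ℂ) • p := by
    rw [hp.1, mul_add, mul_smul_comm, mul_smul_comm, mul_sub, hp.2.1]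
    simp [hp.2.1]
  rw [this, trace_smul, hp.2.2] at h1
  simpa using h1

lemma rho_cont {c : ℝ} {f : M → ℝ} (hc : ContinuousOn f {p | IsP p})
    (h0 : ∀ p, IsP p → 0 ≤ f p) (hf : ∀ p, IsP p → f p + f (1 - p) = c) :
    ContinuousOn (rho c f) {A : M | A.PosSemidef} := by
  intro A hA
  unfold rho
  refine ((continuous_l.continuousWithinAt).mul continuousWithinAt_const).add ?_
  by_cases hs : s A = 0
  · unfold ContinuousWithinAt
    beta_reduce
    rw [hs, zero_mul]
    have hsc : Filter.Tendsto (fun A => s A * c) (nhdsWithin A {A : M | A.PosSemidef}) (nhds 0) := by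
      have : ContinuousWithinAt (fun A => s A * c) {A : M | A.PosSemidef} A :=
        (continuous_s.mul continuous_const).continuousWithinAt
      simpa [ContinuousWithinAt, hs] using this
    refine tendsto_of_tendsto_of_tendsto_of_le_of_le' tendsto_const_nhds hsc ?_ ?_ <;>
      filter_upwards [self_mem_nhdsWithin] with B hB
    · by_cases hB0 : s B = 0
      · simp [hB0]
      · exact mul_nonneg (s_nonneg _) (h0 _ (isP_P hB.1 hB0))
    · by_cases hB0 : s B = 0
      · simp [hB0]
      · have hp := isP_P hB.1 hB0
        exact mul_le_mul_of_nonneg_left (by linarith [h0 _ hp.compl, hf _ hp]) (s_nonneg _)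
  · refine continuous_s.continuousWithinAt.mul ?_
    have hPc : ContinuousAt P A := by
      have h1 : ContinuousAt (fun A => (s A)⁻¹) A := continuous_s.continuousAt.inv₀ hs
      have h2 := continuous_l
      unfold P
      exact (Complex.continuous_ofReal.continuousAt.comp h1).smul (by fun_prop)
    have h3 : Filter.Tendsto P (nhdsWithin A {A : M | A.PosSemidef})
        (nhdsWithin (P A) {p | IsP p}) := by
      refine tendsto_nhdsWithin_iff.2 ⟨hPc.continuousWithinAt, ?_⟩
      have : ∀ᶠ B in nhdsWithin A {A : M | A.PosSemidef}, s B ≠ 0 :=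
        (continuous_s.continuousAt.eventually_ne hs).filter_mono nhdsWithin_le_nhds
      filter_upwards [self_mem_nhdsWithin, this] with B hB hB0
      exact isP_P hB.1 hB0
    exact (hc (P A) (isP_P hA.1 hs)).tendsto.comp h3

end Stmt8Aux

/-- Every continuous nonnegative function `f` on the rank-one projections of `M₂(ℂ)`
with `f(p) + f(1−p)` constant extends to a continuous finite measure `ρ` on the PSD
cone of `M₂(ℂ)`. -/
theorem stmt8 (c : ℝ) (hc : 0 ≤ c) (f : Matrix (Fin 2) (Fin 2) ℂ → ℝ)
    (hf_cont : ContinuousOn f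
      {p : Matrix (Fin 2) (Fin 2) ℂ | pᴴ = p ∧ p * p = p ∧ p.trace = 1})
    (hf_nonneg : ∀ p : Matrix (Fin 2) (Fin 2) ℂ,
      pᴴ = p → p * p = p → p.trace = 1 → 0 ≤ f p)
    (hf_sum : ∀ p : Matrix (Fin 2) (Fin 2) ℂ,
      pᴴ = p → p * p = p → p.trace = 1 → f p + f (1 - p) = c) :
    ∃ ρ : Matrix (Fin 2) (Fin 2) ℂ → ℝ,
      (∀ A : Matrix (Fin 2) (Fin 2) ℂ, A.PosSemidef → 0 ≤ ρ A) ∧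
      (∀ (c' : ℝ) (A : Matrix (Fin 2) (Fin 2) ℂ), 0 ≤ c' → A.PosSemidef →
        ρ ((c' : ℂ) • A) = c' * ρ A) ∧
      (∀ A B : Matrix (Fin 2) (Fin 2) ℂ, A.PosSemidef → B.PosSemidef → A * B = 0 →
        ρ (A + B) = ρ A + ρ B) ∧
      ContinuousOn ρ {A : Matrix (Fin 2) (Fin 2) ℂ | A.PosSemidef} ∧
      (∀ p : Matrix (Fin 2) (Fin 2) ℂ, pᴴ = p → p * p = p → p.trace = 1 → ρ p = f p) ∧
      ρ 1 = c := by
  have hf : ∀ p, Stmt8Aux.IsP p → f p + f (1 - p) = c := fun p hp => hf_sum p hp.1 hp.2.1 hp.2.2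
  have h0 : ∀ p, Stmt8Aux.IsP p → 0 ≤ f p := fun p hp => hf_nonneg p hp.1 hp.2.1 hp.2.2
  refine ⟨Stmt8Aux.rho c f, ?_, ?_, ?_, Stmt8Aux.rho_cont hf_cont h0 hf, ?_, ?_⟩
  · intro A hA
    obtain ⟨a, b, p, hp, rfl⟩ := Stmt8Aux.decomp hA.1
    have ha := Stmt8Aux.psd_coeff hp hA
    have hb : 0 ≤ b := by
      refine Stmt8Aux.psd_coeff (a := b) (b := a) hp.compl ?_
      rwa [sub_sub_cancel, add_comm]
    rw [Stmt8Aux.rho_comb hf hp]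
    have := h0 p hp
    have := h0 _ hp.compl
    positivity
  · intro k A hk hA
    obtain ⟨a, b, p, hp, rfl⟩ := Stmt8Aux.decomp hA.1
    rw [smul_add, smul_smul, smul_smul, ← Complex.ofReal_mul, ← Complex.ofReal_mul,
      Stmt8Aux.rho_comb hf hp, Stmt8Aux.rho_comb hf hp]
    ring
  · intro A B hA hB hAB
    obtain ⟨a, b, p, hp, rfl⟩ := Stmt8Aux.decomp hA.1
    by_cases ha : a = 0
    · by_cases hb : b = 0
      · subst ha hb
        simp [Stmt8Aux.rho_zero]
      · have := Stmt8Aux.add_aux hf hp.compl hB.1 (a := b) (b := a) hb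
          (by rwa [sub_sub_cancel, add_comm])
        rwa [sub_sub_cancel, add_comm ((b : ℂ) • (1 - p))] at this
    · exact Stmt8Aux.add_aux hf hp hB.1 ha hAB
  · intro p h1 h2 h3
    have := Stmt8Aux.rho_comb hf (p := p) ⟨h1, h2, h3⟩ 1 0
    simpa using this
  · have hp : Stmt8Aux.IsP (Stmt8Aux.H 1 0 0 0) := (Stmt8Aux.isP_H _ _ _ _).2 (by norm_num)
    have := Stmt8Aux.rho_comb hf hp 1 1
    rw [← smul_add, add_sub_cancel] at this
    simpa [hf _ hp] using this
end

section
/- Let S ∈ M₂(ℂ) be positive semidefinite and not equal to λ·I for any real λ. Suppose S = A + B = C + D where A, B, C, D are PSD, all nonzero, AB = 0 and CD = 0. Then either (A = C and B = D) or (A = D and B = C). -/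
open Matrix
open scoped ComplexOrder

lemma aux_sq (A : Matrix (Fin 2) (Fin 2) ℂ) (h : A.det = 0) : A * A = A.trace • A := by
  rw [Matrix.det_fin_two] at h
  ext i j
  fin_cases i <;> fin_cases j <;>
    simp [Matrix.mul_apply, Fin.sum_univ_two, Matrix.trace] <;> grind

lemma aux_key (A B : Matrix (Fin 2) (Fin 2) ℂ) (hA : A.PosSemidef) (hB : B.PosSemidef)
    (hA0 : A ≠ 0) (hB0 : B ≠ 0) (h : A * B = 0) :
    B.trace • A + A.trace • B = (A.trace * B.trace) • (1 : Matrix (Fin 2) (Fin 2) ℂ) ∧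
    (A + B) * (A + B) = A.trace • A + B.trace • B := by
  have h' : B * A = 0 := by
    have := congrArg conjTranspose h
    rwa [conjTranspose_mul, hA.1.eq, hB.1.eq, conjTranspose_zero] at this
  have dA : A.det = 0 := by
    by_contra hd
    apply hB0
    have hu : IsUnit A.det := isUnit_iff_ne_zero.mpr hd
    rw [← Matrix.nonsing_inv_mul_cancel_left A B hu, h, Matrix.mul_zero]
  have dB : B.det = 0 := by
    by_contra hd
    apply hA0
    have hu : IsUnit B.det := isUnit_iff_ne_zero.mpr hd
    rw [← Matrix.nonsing_inv_mul_cancel_left B A hu, h', Matrix.mul_zero]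
  have sA := aux_sq A dA
  have sB := aux_sq B dB
  refine ⟨?_, by rw [add_mul, mul_add, mul_add, h, h', sA, sB]; simp⟩
  have rA : star A.trace = A.trace := by rw [← trace_conjTranspose, hA.1.eq]
  have rB : star B.trace = B.trace := by rw [← trace_conjTranspose, hB.1.eq]
  set a := A.trace with ha
  set b := B.trace with hb
  rw [← sub_eq_zero]
  set X := b • A + a • B - (a * b) • (1 : Matrix (Fin 2) (Fin 2) ℂ) with hX
  have hXh : Xᴴ = X := by
    simp only [hX, conjTranspose_sub, conjTranspose_add, conjTranspose_smul, hA.1.eq, hB.1.eq,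
      conjTranspose_one, star_mul', rA, rB]
  have hXA : A * X = 0 := by
    simp only [hX, mul_sub, mul_add, mul_smul_comm, h, sA, mul_one]
    module
  have hXB : B * X = 0 := by
    simp only [hX, mul_sub, mul_add, mul_smul_comm, h', sB, mul_one]
    module
  have hXX : X * X = -(a * b) • X := by
    nth_rewrite 1 [hX]
    simp only [sub_mul, add_mul, smul_mul_assoc, hXA, hXB, one_mul]
    module
  have tX : X.trace = 0 := by
    simp only [hX, trace_sub, trace_add, trace_smul, trace_one, ← ha, ← hb]
    simp
    ring
  rw [← Matrix.trace_conjTranspose_mul_self_eq_zero_iff, hXh, hXX, trace_smul, tX, smul_zero]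

theorem stmt9 (S A B C D : Matrix (Fin 2) (Fin 2) ℂ)
    (hS : S.PosSemidef) (hS_ne : ∀ lam : ℝ, S ≠ (lam : ℂ) • (1 : Matrix (Fin 2) (Fin 2) ℂ))
    (hA : A.PosSemidef) (hB : B.PosSemidef) (hC : C.PosSemidef) (hD : D.PosSemidef)
    (hA0 : A ≠ 0) (hB0 : B ≠ 0) (hC0 : C ≠ 0) (hD0 : D ≠ 0)
    (hAB : S = A + B) (hCD : S = C + D)
    (hABo : A * B = 0) (hCDo : C * D = 0) :
    (A = C ∧ B = D) ∨ (A = D ∧ B = C) := by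
  obtain ⟨k1, q1⟩ := aux_key A B hA hB hA0 hB0 hABo
  obtain ⟨k2, q2⟩ := aux_key C D hC hD hC0 hD0 hCDo
  have rA : star A.trace = A.trace := by rw [← trace_conjTranspose, hA.1.eq]
  have nA : A.trace ≠ 0 := fun h => hA0 (hA.trace_eq_zero_iff.mp h)
  have ht : A.trace + B.trace = C.trace + D.trace := by
    rw [← trace_add, ← trace_add, ← hAB, hCD]
  rw [← hAB] at q1
  rw [← hCD] at q2
  generalize A.trace = a at *
  generalize B.trace = b at *
  generalize C.trace = c at *
  generalize D.trace = d at *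
  have hne : a - b ≠ 0 := by
    intro h
    obtain rfl : a = b := sub_eq_zero.mp h
    apply hS_ne a.re
    rw [Complex.conj_eq_iff_re.mp rA]
    rw [← smul_add, ← hAB, mul_smul] at k1
    exact smul_right_injective _ nA k1
  have e1 : S * S = (a + b) • S - (a * b) • (1 : Matrix (Fin 2) (Fin 2) ℂ) := by
    rw [q1, ← k1, hAB]; module
  have e2 : S * S = (c + d) • S - (c * d) • (1 : Matrix (Fin 2) (Fin 2) ℂ) := by
    rw [q2, ← k2, hCD]; module
  have hp : a * b = c * d := by
    rw [e1, ht] at e2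
    have := congrFun (congrFun (sub_right_injective e2) 0) 0
    simpa using this
  have f1 : (a - b) • A = a • S - (a * b) • (1 : Matrix (Fin 2) (Fin 2) ℂ) := by
    rw [← k1, hAB]; module
  have f2 : (c - d) • C = c • S - (c * d) • (1 : Matrix (Fin 2) (Fin 2) ℂ) := by
    rw [← k2, hCD]; module
  have f3 : (d - c) • D = d • S - (c * d) • (1 : Matrix (Fin 2) (Fin 2) ℂ) := by
    rw [← k2, hCD]; module
  have hz : (a - c) * (a - d) = 0 := by linear_combination a * ht - hp
  rcases mul_eq_zero.mp hz with h | h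
  · left
    obtain rfl : a = c := sub_eq_zero.mp h
    obtain rfl : b = d := add_left_cancel ht
    have hAC : A = C := smul_right_injective _ hne (f1.trans f2.symm)
    refine ⟨hAC, ?_⟩
    rw [hAB, hAC] at hCD
    exact add_left_cancel hCD
  · right
    obtain rfl : a = d := sub_eq_zero.mp h
    obtain rfl : b = c := by linear_combination ht
    rw [← hp] at f3
    have hAC : A = D := smul_right_injective _ hne (f1.trans f3.symm)
    refine ⟨hAC, ?_⟩
    rw [hAB, hAC, add_comm] at hCD
    exact add_right_cancel hCD
end

section
/- Let A be a C*-algebra, let a, b ∈ A with 0 ≤ a and 0 ≤ b, and let u, v, w ∈ A. Suppose that u·a·u* + v·b·v* = w·a·w* + w·b·w* and u·a + v·b = w·a + w·b. Then u·a^{1/2} = w·a^{1/2} and v·b^{1/2} = w·b^{1/2}, where a^{1/2}, b^{1/2} denote the positive square roots of a and b. -/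
/-- In a C*-algebra: if `u·a·u* + v·b·v* = w·a·w* + w·b·w*` and `u·a + v·b = w·a + w·b`
for positive `a, b`, then `u·a^{1/2} = w·a^{1/2}` and `v·b^{1/2} = w·b^{1/2}`,
where `CFC.sqrt` is the positive square root given by the continuous functional
calculus. -/
theorem stmt11 {A : Type*} [CStarAlgebra A] [PartialOrder A] [StarOrderedRing A]
    (a b : A) (ha : 0 ≤ a) (hb : 0 ≤ b) (u v w : A)
    (h1 : u * a * star u + v * b * star v = w * a * star w + w * b * star w)
    (h2 : u * a + v * b = w * a + w * b) :
    u * CFC.sqrt a = w * CFC.sqrt a ∧ v * CFC.sqrt b = w * CFC.sqrt b := by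
  have sa : star a = a := (IsSelfAdjoint.of_nonneg ha).star_eq
  have sb : star b = b := (IsSelfAdjoint.of_nonneg hb).star_eq
  have h3 : a * star u + b * star v = a * star w + b * star w := by
    have := congrArg star h2
    simpa only [star_add, star_mul, sa, sb] using this
  have h4 : (u - w) * a * star (u - w) + (v - w) * b * star (v - w) = 0 := by
    have e : (u - w) * a * star (u - w) + (v - w) * b * star (v - w)
        = (u * a * star u + v * b * star v) - (u * a + v * b) * star w
          - w * (a * star u + b * star v) + (w * a * star w + w * b * star w) := by
      rw [star_sub, star_sub]; noncomm_ring
    rw [e, h1, h2, h3]; noncomm_ring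
  have pa : 0 ≤ (u - w) * a * star (u - w) := star_right_conjugate_nonneg ha _
  have pb : 0 ≤ (v - w) * b * star (v - w) := star_right_conjugate_nonneg hb _
  obtain ⟨za, zb⟩ := (add_eq_zero_iff_of_nonneg pa pb).1 h4
  have key : ∀ x c : A, 0 ≤ c → x * c * star x = 0 → x * CFC.sqrt c = 0 := by
    intro x c hc h
    have ss : star (CFC.sqrt c) = CFC.sqrt c :=
      (IsSelfAdjoint.of_nonneg (CFC.sqrt_nonneg c)).star_eq
    rw [← CStarRing.mul_star_self_eq_zero_iff, star_mul, ss, ← h]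
    conv_rhs => rw [← CFC.sqrt_mul_sqrt_self c hc]
    noncomm_ring
  have ka := key _ _ ha za
  have kb := key _ _ hb zb
  rw [sub_mul, sub_eq_zero] at ka kb
  exact ⟨ka, kb⟩
end

section
/- Let A be a unital ring and let α : ℝ → Aut(A) be a one-parameter group of ring automorphisms (α₀ = id and α_{s+t} = α_s ∘ α_t for all s, t ∈ ℝ) such that α_t(z) = z for every t ∈ ℝ and every central element z ∈ A. Suppose u ∈ A satisfies u² = 1 and u·α_t(u) is central in A for every t ∈ ℝ. Then α_t(u) = u for all t ∈ ℝ. -/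
/-- If a one-parameter group of ring automorphisms fixes the center pointwise, and a
symmetry `u` (i.e. `u² = 1`) satisfies that `u·α_t(u)` is central for every `t`, then
`α_t(u) = u` for all `t`. -/
theorem stmt12 {A : Type*} [Ring A] (α : ℝ → A ≃+* A)
    (hα0 : ∀ x : A, α 0 x = x)
    (hαadd : ∀ (s t : ℝ) (x : A), α (s + t) x = α s (α t x))
    (hcentral : ∀ (t : ℝ) (z : A), (∀ y : A, z * y = y * z) → α t z = z)
    (u : A) (hu : u * u = 1)
    (huc : ∀ (t : ℝ) (y : A), (u * α t u) * y = y * (u * α t u)) :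
    ∀ t : ℝ, α t u = u := by
  intro t
  obtain ⟨s, rfl⟩ : ∃ s : ℝ, t = s + s := ⟨t / 2, by ring⟩
  obtain ⟨z, hz⟩ : ∃ z, z = u * α s u := ⟨_, rfl⟩
  have hc : ∀ y, z * y = y * z := by
    intro y
    rw [hz]
    exact huc s y
  have h1 : α s u = u * z := by rw [hz, ← mul_assoc, hu, one_mul]
  have h2 : z * z = 1 := by
    have h3 : α s u * α s u = 1 := by rw [← map_mul, hu, map_one]
    rw [h1, mul_assoc, ← mul_assoc z u z, hc u, mul_assoc u z z, ← mul_assoc u u, hu,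
      one_mul] at h3
    exact h3
  rw [hαadd, h1, map_mul, hcentral s z hc, h1, mul_assoc, h2, mul_one]
end

section
/- Let A be a unital C*-algebra and let Φ : A → A be a linear map that is positive (0 ≤ x implies 0 ≤ Φ(x)) and faithful (0 ≤ x and Φ(x) = 0 imply x = 0). Let q, q' ∈ A be projections (self-adjoint idempotents) such that Φ(q) = q, Φ(q') = q, and Φ(q·y·q) = q·Φ(y)·q for all y ∈ A. Then q·q' = q'·q = q; in particular q ≤ q'. -/
/-- Uniqueness lemma for typical isometries: if `Φ` is a positive faithful linear map
on a unital C*-algebra fixing a projection `q`, sending a projection `q'` to `q`, and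
satisfying `Φ(q·y·q) = q·Φ(y)·q`, then `q·q' = q'·q = q`, i.e. `q ≤ q'`. -/
theorem stmt13 {A : Type*} [CStarAlgebra A] [PartialOrder A] [StarOrderedRing A]
    (Φ : A →ₗ[ℂ] A)
    (hpos : ∀ x : A, 0 ≤ x → 0 ≤ Φ x)
    (hfaithful : ∀ x : A, 0 ≤ x → Φ x = 0 → x = 0)
    (q q' : A) (hq : star q = q ∧ q * q = q) (hq' : star q' = q' ∧ q' * q' = q')
    (hΦq : Φ q = q) (hΦq' : Φ q' = q)
    (hmod : ∀ y : A, Φ (q * y * q) = q * Φ y * q) :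
    q * q' = q ∧ q' * q = q := by
  obtain ⟨hs, hi⟩ := hq
  obtain ⟨hs', hi'⟩ := hq'
  have hx : star (q - q' * q) * (q - q' * q) = q - q * q' * q := by
    have h1 : q * q' * (q' * q) = q * q' * q := by
      rw [mul_assoc, ← mul_assoc q' q' q, hi', ← mul_assoc]
    rw [star_sub, star_mul, hs, hs', sub_mul, mul_sub, mul_sub, hi, h1, ← mul_assoc]
    simp
  have h0 : Φ (q - q * q' * q) = 0 := by
    rw [map_sub, hmod, hΦq, hΦq', hi, hi, sub_self]
  have h2 := hfaithful _ (hx ▸ star_mul_self_nonneg (q - q' * q)) h0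
  rw [← hx, CStarRing.star_mul_self_eq_zero_iff, sub_eq_zero] at h2
  refine ⟨?_, h2.symm⟩
  have h3 := congrArg star h2
  rw [star_mul, hs, hs'] at h3
  exact h3.symm
end

section
/- Let J : M₂(ℂ) → M₄(ℂ) be the map sending x to the block-diagonal matrix diag(x, xᵀ), where xᵀ is the transpose of x. Then J is ℂ-linear, injective, unital (J(1) = 1), star-preserving (J(xᴴ) = J(x)ᴴ for all x), and satisfies J(xy + yx) = J(x)J(y) + J(y)J(x) for all x, y ∈ M₂(ℂ); however, the range of J is not closed under matrix multiplication: there exist x, y ∈ M₂(ℂ) such that J(x)·J(y) is not of the form J(z) for any z ∈ M₂(ℂ). -/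
open Matrix

/-- The map `x ↦ diag(x, xᵀ) : M₂(ℂ) → M₄(ℂ)`. -/
noncomputable def Jmap (x : Matrix (Fin 2) (Fin 2) ℂ) : Matrix (Fin 4) (Fin 4) ℂ :=
  Matrix.reindex finSumFinEquiv finSumFinEquiv (Matrix.fromBlocks x 0 0 xᵀ)

theorem Jmap_mul_aux (x y : Matrix (Fin 2) (Fin 2) ℂ) : Jmap x * Jmap y =
    Matrix.reindex finSumFinEquiv finSumFinEquiv (Matrix.fromBlocks (x * y) 0 0 (xᵀ * yᵀ)) := by
  unfold Jmap
  simp only [Matrix.reindex_apply]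
  rw [Matrix.submatrix_mul_equiv, Matrix.fromBlocks_multiply]
  simp

/-- The map `x ↦ diag(x, xᵀ)` is a unital Jordan *-monomorphism `M₂(ℂ) → M₄(ℂ)`
whose range is not closed under matrix multiplication. -/
theorem stmt14 :
    IsLinearMap ℂ Jmap ∧
    Function.Injective Jmap ∧
    Jmap 1 = 1 ∧
    (∀ x : Matrix (Fin 2) (Fin 2) ℂ, Jmap xᴴ = (Jmap x)ᴴ) ∧
    (∀ x y : Matrix (Fin 2) (Fin 2) ℂ,
      Jmap (x * y + y * x) = Jmap x * Jmap y + Jmap y * Jmap x) ∧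
    (∃ x y : Matrix (Fin 2) (Fin 2) ℂ,
      ∀ z : Matrix (Fin 2) (Fin 2) ℂ, Jmap x * Jmap y ≠ Jmap z) := by
  refine ⟨⟨fun x y => ?_, fun c x => ?_⟩, fun x y h => ?_, ?_, fun x => ?_, fun x y => ?_, ?_⟩
  · unfold Jmap
    refine Eq.trans (congrArg (Matrix.reindex finSumFinEquiv finSumFinEquiv) ?_)
      (rfl : Matrix.reindex finSumFinEquiv finSumFinEquiv (Matrix.fromBlocks x 0 0 xᵀ + Matrix.fromBlocks y 0 0 yᵀ) = _)
    rw [Matrix.fromBlocks_add]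
    simp
  · unfold Jmap
    refine Eq.trans (congrArg (Matrix.reindex finSumFinEquiv finSumFinEquiv) ?_)
      (rfl : Matrix.reindex finSumFinEquiv finSumFinEquiv (c • Matrix.fromBlocks x 0 0 xᵀ) = _)
    rw [Matrix.fromBlocks_smul]
    simp
  · have h2 := (Matrix.reindex finSumFinEquiv finSumFinEquiv).injective h
    exact (Matrix.fromBlocks_inj.mp h2).1
  · unfold Jmap
    simp
  · unfold Jmap
    rw [Matrix.conjTranspose_reindex, Matrix.fromBlocks_conjTranspose]
    simp only [Matrix.conjTranspose_zero]
    rfl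
  · rw [Jmap_mul_aux, Jmap_mul_aux]
    unfold Jmap
    refine Eq.trans (congrArg (Matrix.reindex finSumFinEquiv finSumFinEquiv) ?_)
      (rfl : Matrix.reindex finSumFinEquiv finSumFinEquiv (Matrix.fromBlocks (x * y) 0 0 (xᵀ * yᵀ) +
        Matrix.fromBlocks (y * x) 0 0 (yᵀ * xᵀ)) = _)
    rw [Matrix.fromBlocks_add]
    simp [Matrix.transpose_mul, add_comm]
  · refine ⟨!![0, 1; 0, 0], !![0, 0; 1, 0], fun z h => ?_⟩
    rw [Jmap_mul_aux] at h
    have h2 := (Matrix.reindex finSumFinEquiv finSumFinEquiv).injective h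
    obtain ⟨h3, -, -, h4⟩ := Matrix.fromBlocks_inj.mp h2
    rw [← h3] at h4
    have := congrFun (congrFun h4 0) 0
    simp [Matrix.mul_apply, Fin.sum_univ_two] at this
end
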